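/- arXiv:2512.01745 — 2 statements merged into one kernel-verified Lean document; each statement's English description precedes it below -/
import Mathlib

section
/- For any quantum channel N: A→B, the channel entropy satisfies S(N) = inf over pure states ψ_AR, with reference system R of dimension |R| = |A|, of H(B|R)_{(N⊗I_R)(ψ)}, where H(B|R)_ρ = S(ρ_BR) − S(ρ_R) is the conditional von Neumann entropy. -/
open scoped Kronecker ComplexOrder

noncomputable section

namespace QIT

variable {n : Type*} [Fintype n] [DecidableEq n]

/-- Real trace of a complex matrix. -/
def rtr (A : Matrix n n ℂ) : ℝ := (Matrix.trace A).re

/-- Apply a real function to a hermitian matrix via spectral decomposition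
(junk value `0` for non-hermitian input). -/
def mfun (f : ℝ → ℝ) (A : Matrix n n ℂ) : Matrix n n ℂ :=
  if hA : A.IsHermitian then
    (Matrix.IsHermitian.eigenvectorUnitary hA : Matrix n n ℂ) *
      Matrix.diagonal (fun i => ((f (hA.eigenvalues i) : ℝ) : ℂ)) *
      (star (Matrix.IsHermitian.eigenvectorUnitary hA : Matrix n n ℂ))
  else 0

/-- Real power of a positive semidefinite matrix (with the conventions
`0 ^ p = 0` for `p ≠ 0`, i.e. powers are taken on the support). -/
def mpow (A : Matrix n n ℂ) (p : ℝ) : Matrix n n ℂ := mfun (fun x => x ^ p) A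

/-- Matrix base-2 logarithm (on the support). -/
def mlog (A : Matrix n n ℂ) : Matrix n n ℂ := mfun (Real.logb 2) A

/-- A quantum state: positive semidefinite with unit trace. -/
def IsState (ρ : Matrix n n ℂ) : Prop := ρ.PosSemidef ∧ Matrix.trace ρ = 1

/-- A pure state: a state of rank one. -/
def IsPureState (ρ : Matrix n n ℂ) : Prop := IsState ρ ∧ ρ.rank = 1

/-- The support (range) ordering: `supp ρ ⊆ supp σ`, expressed as
`ker σ ≤ ker ρ`. -/
def SuppLE (ρ σ : Matrix n n ℂ) : Prop := ∀ v : n → ℂ, σ.mulVec v = 0 → ρ.mulVec v = 0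

/-- Trace norm ‖X‖₁ = Tr √(X† X). -/
def traceNorm (X : Matrix n n ℂ) : ℝ := rtr (mpow (X.conjTranspose * X) (2⁻¹ : ℝ))

/-- von Neumann entropy (base 2). -/
def vnEnt (ρ : Matrix n n ℂ) : ℝ := - rtr (ρ * mlog ρ)

/-- Umegaki relative entropy (base 2), real-valued on its finiteness domain. -/
def relEnt (ρ σ : Matrix n n ℂ) : ℝ := rtr (ρ * mlog ρ) - rtr (ρ * mlog σ)

/-- The sandwiched trace functional Tr{(σ^((1-α)/(2α)) ρ σ^((1-α)/(2α)))^α}. -/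
def sandTr (α : ℝ) (ρ σ : Matrix n n ℂ) : ℝ :=
  rtr (mpow (mpow σ ((1 - α) / (2 * α)) * ρ * mpow σ ((1 - α) / (2 * α))) α)

/-- Sandwiched Rényi relative entropy (base 2). -/
def sandRenyi (α : ℝ) (ρ σ : Matrix n n ℂ) : ℝ := (α - 1)⁻¹ * Real.logb 2 (sandTr α ρ σ)

/-- Sandwiched Tsallis relative entropy. -/
def sandTsallis (α : ℝ) (ρ σ : Matrix n n ℂ) : ℝ := (α - 1)⁻¹ * (sandTr α ρ σ - 1)

/-- (Non-sandwiched) Tsallis relative entropy. -/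
def tsallisRel (α : ℝ) (ρ σ : Matrix n n ℂ) : ℝ :=
  (α - 1)⁻¹ * (rtr (mpow ρ α * mpow σ (1 - α)) - 1)

/-- Tsallis entropy of a state. -/
def tsallisEnt (α : ℝ) (ρ : Matrix n n ℂ) : ℝ := (1 - α)⁻¹ * (rtr (mpow ρ α) - 1)

variable {a b c r : Type*} [Fintype a] [DecidableEq a] [Fintype b] [DecidableEq b]
  [Fintype c] [DecidableEq c] [Fintype r] [DecidableEq r]

/-- Partial trace over the first tensor factor. -/
def ptraceA (ρ : Matrix (a × b) (a × b) ℂ) : Matrix b b ℂ :=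
  Matrix.of fun i j => ∑ k : a, ρ (k, i) (k, j)

/-- Partial trace over the second tensor factor. -/
def ptraceB (ρ : Matrix (a × b) (a × b) ℂ) : Matrix a a ℂ :=
  Matrix.of fun i j => ∑ k : b, ρ (i, k) (j, k)

/-- Conditional sandwiched Rényi entropy H̃↓_α(A|B). -/
def condRenyiDown (α : ℝ) (ρ : Matrix (a × b) (a × b) ℂ) : ℝ :=
  - sandRenyi α ρ ((1 : Matrix a a ℂ) ⊗ₖ ptraceA ρ)

/-- Conditional sandwiched Tsallis entropy T̃↓_α(A|B). -/
def condTsallisSandDown (α : ℝ) (ρ : Matrix (a × b) (a × b) ℂ) : ℝ :=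
  - sandTsallis α ρ ((1 : Matrix a a ℂ) ⊗ₖ ptraceA ρ)

/-- Optimized conditional sandwiched Tsallis entropy T̃↑_α(A|B). -/
def condTsallisSandUp (α : ℝ) (ρ : Matrix (a × b) (a × b) ℂ) : ℝ :=
  - ⨅ σ : {σ : Matrix b b ℂ // IsState σ}, sandTsallis α ρ ((1 : Matrix a a ℂ) ⊗ₖ σ.1)

/-- Conditional (non-sandwiched) Tsallis entropy T↓_α(A|B). -/
def condTsallisDown (α : ℝ) (ρ : Matrix (a × b) (a × b) ℂ) : ℝ :=
  - tsallisRel α ρ ((1 : Matrix a a ℂ) ⊗ₖ ptraceA ρ)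

/-- Conditional von Neumann entropy H(A|B) = S(AB) - S(B). -/
def condvnEnt (ρ : Matrix (a × b) (a × b) ℂ) : ℝ := vnEnt ρ - vnEnt (ptraceA ρ)

/-- The extension `N ⊗ I_r` of a linear map on matrices. -/
def tensorId (N : Matrix a a ℂ →ₗ[ℂ] Matrix b b ℂ) (r : Type*) [Fintype r] [DecidableEq r] :
    Matrix (a × r) (a × r) ℂ →ₗ[ℂ] Matrix (b × r) (b × r) ℂ where
  toFun ρ := Matrix.of fun p q => N (Matrix.of fun x y => ρ (x, p.2) (y, q.2)) p.1 q.1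
  map_add' ρ₁ ρ₂ := by
    ext p q
    have h : (Matrix.of fun x y => (ρ₁ + ρ₂) (x, p.2) (y, q.2))
        = (Matrix.of fun x y => ρ₁ (x, p.2) (y, q.2))
          + (Matrix.of fun x y => ρ₂ (x, p.2) (y, q.2)) := by
      ext x y; simp
    show N (Matrix.of fun x y => (ρ₁ + ρ₂) (x, p.2) (y, q.2)) p.1 q.1 = _
    rw [h, map_add]; rfl
  map_smul' z ρ := by
    ext p q
    have h : (Matrix.of fun x y => (z • ρ) (x, p.2) (y, q.2))
        = z • (Matrix.of fun x y => ρ (x, p.2) (y, q.2)) := by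
      ext x y; simp
    show N (Matrix.of fun x y => (z • ρ) (x, p.2) (y, q.2)) p.1 q.1 = _
    rw [h, map_smul]; rfl

/-- The extension `I_r ⊗ M` of a linear map on matrices. -/
def idTensor (M : Matrix a a ℂ →ₗ[ℂ] Matrix b b ℂ) (r : Type*) [Fintype r] [DecidableEq r] :
    Matrix (r × a) (r × a) ℂ →ₗ[ℂ] Matrix (r × b) (r × b) ℂ where
  toFun ρ := Matrix.of fun p q => M (Matrix.of fun x y => ρ (p.1, x) (q.1, y)) p.2 q.2
  map_add' ρ₁ ρ₂ := by
    ext p q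
    have h : (Matrix.of fun x y => (ρ₁ + ρ₂) (p.1, x) (q.1, y))
        = (Matrix.of fun x y => ρ₁ (p.1, x) (q.1, y))
          + (Matrix.of fun x y => ρ₂ (p.1, x) (q.1, y)) := by
      ext x y; simp
    show M (Matrix.of fun x y => (ρ₁ + ρ₂) (p.1, x) (q.1, y)) p.2 q.2 = _
    rw [h, map_add]; rfl
  map_smul' z ρ := by
    ext p q
    have h : (Matrix.of fun x y => (z • ρ) (p.1, x) (q.1, y))
        = z • (Matrix.of fun x y => ρ (p.1, x) (q.1, y)) := by
      ext x y; simp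
    show M (Matrix.of fun x y => (z • ρ) (p.1, x) (q.1, y)) p.2 q.2 = _
    rw [h, map_smul]; rfl

/-- A quantum channel: trace preserving and completely positive. -/
def IsChannel (N : Matrix a a ℂ →ₗ[ℂ] Matrix b b ℂ) : Prop :=
  (∀ ρ : Matrix a a ℂ, Matrix.trace (N ρ) = Matrix.trace ρ) ∧
  ∀ (k : ℕ) (ρ : Matrix (a × Fin k) (a × Fin k) ℂ), ρ.PosSemidef →
    (tensorId N (Fin k) ρ).PosSemidef

/-- The maximally mixed state on system `b`. -/
def maxMixed (b : Type*) [Fintype b] [DecidableEq b] : Matrix b b ℂ :=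
  ((Fintype.card b : ℂ))⁻¹ • (1 : Matrix b b ℂ)

/-- The completely randomizing (depolarizing) channel. -/
def randomizing (a b : Type*) [Fintype a] [DecidableEq a] [Fintype b] [DecidableEq b] :
    Matrix a a ℂ →ₗ[ℂ] Matrix b b ℂ :=
  (Matrix.traceLinearMap a ℂ ℂ).smulRight (maxMixed b)

/-- The replacer channel `ρ ↦ Tr(ρ) σ`. -/
def replacer (a : Type*) [Fintype a] [DecidableEq a] (σ : Matrix b b ℂ) :
    Matrix a a ℂ →ₗ[ℂ] Matrix b b ℂ :=
  (Matrix.traceLinearMap a ℂ ℂ).smulRight σ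

/-- Channel (Umegaki) relative entropy: supremum over all finite reference systems. -/
def chRelEnt (N M : Matrix a a ℂ →ₗ[ℂ] Matrix b b ℂ) : ℝ :=
  ⨆ p : Σ k : ℕ, {ρ : Matrix (a × Fin k) (a × Fin k) ℂ // IsState ρ},
    relEnt (tensorId N (Fin p.1) p.2.1) (tensorId M (Fin p.1) p.2.1)

/-- Channel sandwiched Rényi relative entropy. -/
def chSandRenyi (α : ℝ) (N M : Matrix a a ℂ →ₗ[ℂ] Matrix b b ℂ) : ℝ :=
  ⨆ p : Σ k : ℕ, {ρ : Matrix (a × Fin k) (a × Fin k) ℂ // IsState ρ},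
    sandRenyi α (tensorId N (Fin p.1) p.2.1) (tensorId M (Fin p.1) p.2.1)

/-- Channel sandwiched Tsallis relative entropy. -/
def chSandTsallis (α : ℝ) (N M : Matrix a a ℂ →ₗ[ℂ] Matrix b b ℂ) : ℝ :=
  ⨆ p : Σ k : ℕ, {ρ : Matrix (a × Fin k) (a × Fin k) ℂ // IsState ρ},
    sandTsallis α (tensorId N (Fin p.1) p.2.1) (tensorId M (Fin p.1) p.2.1)

/-- Diamond distance between two maps. -/
def diamondDist (N M : Matrix a a ℂ →ₗ[ℂ] Matrix b b ℂ) : ℝ :=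
  ⨆ p : Σ k : ℕ, {ρ : Matrix (a × Fin k) (a × Fin k) ℂ // IsState ρ},
    traceNorm (tensorId N (Fin p.1) p.2.1 - tensorId M (Fin p.1) p.2.1)

/-- Entropy of a quantum channel. -/
def chEnt (N : Matrix a a ℂ →ₗ[ℂ] Matrix b b ℂ) : ℝ :=
  Real.logb 2 (Fintype.card b) - chRelEnt N (randomizing a b)

/-- α-Rényi entropy of a quantum channel. -/
def chRenyiEnt (α : ℝ) (N : Matrix a a ℂ →ₗ[ℂ] Matrix b b ℂ) : ℝ :=
  Real.logb 2 (Fintype.card b) - chSandRenyi α N (randomizing a b)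

/-- α-Tsallis entropy of a quantum channel. -/
def chTsallisEnt (α : ℝ) (N : Matrix a a ℂ →ₗ[ℂ] Matrix b b ℂ) : ℝ :=
  ((Fintype.card b : ℝ) ^ (1 - α) - 1) / (1 - α)
    - (Fintype.card b : ℝ) ^ (1 - α) * chSandTsallis α N (randomizing a b)


section Calculus

open Matrix

/-- The unitary matrix of eigenvectors of a hermitian matrix. -/
def eigU {A : Matrix n n ℂ} (hA : A.IsHermitian) : Matrix n n ℂ := hA.eigenvectorUnitary

/-- The diagonal matrix with real entries `d`. -/
def rdiag (d : n → ℝ) : Matrix n n ℂ := diagonal fun i => ((d i : ℝ) : ℂ)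

lemma eigU_star_mul {A : Matrix n n ℂ} (hA : A.IsHermitian) : (eigU hA)ᴴ * eigU hA = 1 :=
  Unitary.coe_star_mul_self hA.eigenvectorUnitary

lemma eigU_mul_star {A : Matrix n n ℂ} (hA : A.IsHermitian) : eigU hA * (eigU hA)ᴴ = 1 :=
  Unitary.coe_mul_star_self hA.eigenvectorUnitary

lemma eigU_star_mul_assoc {m : Type*} {A : Matrix n n ℂ} (hA : A.IsHermitian) (X : Matrix n m ℂ) :
    (eigU hA)ᴴ * (eigU hA * X) = X := by
  rw [← Matrix.mul_assoc, eigU_star_mul, Matrix.one_mul]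

lemma eigU_mul_star_assoc {m : Type*} {A : Matrix n n ℂ} (hA : A.IsHermitian) (X : Matrix n m ℂ) :
    eigU hA * ((eigU hA)ᴴ * X) = X := by
  rw [← Matrix.mul_assoc, eigU_mul_star, Matrix.one_mul]

lemma mfun_eq {A : Matrix n n ℂ} (hA : A.IsHermitian) (f : ℝ → ℝ) :
    mfun f A = eigU hA * rdiag (fun i => f (hA.eigenvalues i)) * (eigU hA)ᴴ := by
  rw [mfun, dif_pos hA]; rfl

lemma eq_eigU_conj {A : Matrix n n ℂ} (hA : A.IsHermitian) :
    A = eigU hA * rdiag hA.eigenvalues * (eigU hA)ᴴ :=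
  hA.spectral_theorem

lemma eigU_star_mul_self {A : Matrix n n ℂ} (hA : A.IsHermitian) :
    (eigU hA)ᴴ * A = rdiag hA.eigenvalues * (eigU hA)ᴴ := by
  have h := congrArg (fun Z => (eigU hA)ᴴ * Z) (eq_eigU_conj hA)
  simpa only [Matrix.mul_assoc, eigU_star_mul_assoc] using h

lemma self_mul_eigU {A : Matrix n n ℂ} (hA : A.IsHermitian) :
    A * eigU hA = eigU hA * rdiag hA.eigenvalues := by
  have h := congrArg (fun Z => Z * eigU hA) (eq_eigU_conj hA)
  simpa only [Matrix.mul_assoc, eigU_star_mul, Matrix.mul_one] using h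

lemma rdiag_mul (d e : n → ℝ) : rdiag d * rdiag e = rdiag (fun i => d i * e i) := by
  simp [rdiag]

omit [Fintype n] in
lemma rdiag_conjTranspose (d : n → ℝ) : (rdiag d)ᴴ = rdiag d := by
  simp [rdiag, diagonal_conjTranspose]

lemma mfun_congr {A : Matrix n n ℂ} (hA : A.IsHermitian) {f g : ℝ → ℝ}
    (h : ∀ i, f (hA.eigenvalues i) = g (hA.eigenvalues i)) : mfun f A = mfun g A := by
  rw [mfun_eq hA, mfun_eq hA]; simp_rw [h]

lemma mfun_id {A : Matrix n n ℂ} (hA : A.IsHermitian) : mfun (fun x => x) A = A := by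
  rw [mfun_eq hA]; exact (eq_eigU_conj hA).symm

lemma mfun_zero {A : Matrix n n ℂ} (hA : A.IsHermitian) : mfun (fun _ => 0) A = 0 := by
  rw [mfun_eq hA]; simp [rdiag]

lemma mfun_one {A : Matrix n n ℂ} (hA : A.IsHermitian) : mfun (fun _ => 1) A = 1 := by
  rw [mfun_eq hA]; simp [rdiag, eigU_mul_star]

lemma mfun_mul_mfun {A : Matrix n n ℂ} (hA : A.IsHermitian) (f g : ℝ → ℝ) :
    mfun f A * mfun g A = mfun (fun x => f x * g x) A := by
  simp only [mfun_eq hA, ← rdiag_mul, Matrix.mul_assoc, eigU_star_mul_assoc]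

lemma mfun_sub {A : Matrix n n ℂ} (hA : A.IsHermitian) (f g : ℝ → ℝ) :
    mfun f A - mfun g A = mfun (fun x => f x - g x) A := by
  simp only [mfun_eq hA, ← Matrix.sub_mul, ← Matrix.mul_sub]
  congr 2
  simp [rdiag]

lemma mfun_smul {A : Matrix n n ℂ} (hA : A.IsHermitian) (c : ℝ) :
    mfun (fun x => c * x) A = (c : ℂ) • A := by
  conv_rhs => rw [eq_eigU_conj hA]
  rw [mfun_eq hA, ← Matrix.smul_mul, ← Matrix.mul_smul]
  congr 2
  ext i j
  simp [rdiag, diagonal_apply]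

lemma mfun_conjTranspose {A : Matrix n n ℂ} (hA : A.IsHermitian) (f : ℝ → ℝ) :
    (mfun f A)ᴴ = mfun f A := by
  simp only [mfun_eq hA, conjTranspose_mul, conjTranspose_conjTranspose, rdiag_conjTranspose,
    Matrix.mul_assoc]

lemma rtr_mfun {A : Matrix n n ℂ} (hA : A.IsHermitian) (f : ℝ → ℝ) :
    rtr (mfun f A) = ∑ i, f (hA.eigenvalues i) := by
  rw [rtr, mfun_eq hA, Matrix.mul_assoc, trace_mul_comm, Matrix.mul_assoc, eigU_star_mul,
    Matrix.mul_one, rdiag, trace_diagonal]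
  simp

lemma mfun_intertwine {m : Type*} [Fintype m] [DecidableEq m] {A : Matrix n n ℂ}
    {B : Matrix m m ℂ} (hA : A.IsHermitian) (hB : B.IsHermitian) (f g : ℝ → ℝ) {X : Matrix n m ℂ} (h : A * X = X * mfun g B) :
    mfun f A * X = X * mfun (fun x => f (g x)) B := by
  have key : rdiag hA.eigenvalues * ((eigU hA)ᴴ * X * eigU hB) =
      ((eigU hA)ᴴ * X * eigU hB) * rdiag (fun i => g (hB.eigenvalues i)) := by
    have h1 := congrArg (fun Z => (eigU hA)ᴴ * Z * eigU hB) h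
    simp only [mfun_eq hB] at h1
    rw [← Matrix.mul_assoc _ A, eigU_star_mul_self hA] at h1
    simpa only [Matrix.mul_assoc, eigU_star_mul_assoc, eigU_star_mul, Matrix.mul_one] using h1
  have key2 : rdiag (fun i => f (hA.eigenvalues i)) * ((eigU hA)ᴴ * X * eigU hB) =
      ((eigU hA)ᴴ * X * eigU hB) * rdiag (fun i => f (g (hB.eigenvalues i))) := by
    generalize (eigU hA)ᴴ * X * eigU hB = Y at key
    ext i j
    have hij := congrFun (congrFun key i) j
    simp only [rdiag, diagonal_mul, mul_diagonal] at hij ⊢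
    rw [mul_comm (Y i j)] at hij ⊢
    by_cases hy : Y i j = 0
    · simp [hy]
    · have := mul_right_cancel₀ hy hij
      rw [Complex.ofReal_inj] at this
      rw [this]
  have h2 := congrArg (fun Z => eigU hA * Z * (eigU hB)ᴴ) key2
  simp only [mfun_eq hA, mfun_eq hB]
  simpa only [Matrix.mul_assoc, eigU_mul_star_assoc, eigU_mul_star, Matrix.mul_one] using h2

/-- Overlap weights `|⟨uᵢ, vⱼ⟩|²` of the eigenbases of two hermitian matrices. -/
def overlap {A B : Matrix n n ℂ} (hA : A.IsHermitian) (hB : B.IsHermitian) (i j : n) : ℝ :=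
  Complex.normSq (((eigU hA)ᴴ * eigU hB) i j)

lemma sum_overlap {A B : Matrix n n ℂ} (hA : A.IsHermitian) (hB : B.IsHermitian) (i : n) :
    ∑ j, overlap hA hB i j = 1 := by
  have h : ((eigU hA)ᴴ * eigU hB) * ((eigU hA)ᴴ * eigU hB)ᴴ = 1 := by
    rw [conjTranspose_mul, conjTranspose_conjTranspose, Matrix.mul_assoc, eigU_mul_star_assoc,
      eigU_star_mul]
  have h2 := congrFun (congrFun h i) i
  rw [Matrix.mul_apply, one_apply_eq] at h2
  simp only [conjTranspose_apply, RCLike.star_def, Complex.mul_conj] at h2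
  exact_mod_cast h2

lemma rtr_mul_mfun {A B : Matrix n n ℂ} (hA : A.IsHermitian) (hB : B.IsHermitian) (f : ℝ → ℝ) :
    rtr (A * mfun f B) =
      ∑ i, ∑ j, overlap hA hB i j * (hA.eigenvalues i * f (hB.eigenvalues j)) := by
  have h : trace (A * mfun f B) = trace (rdiag hA.eigenvalues * (((eigU hA)ᴴ * eigU hB) *
      (rdiag (fun i => f (hB.eigenvalues i)) * ((eigU hA)ᴴ * eigU hB)ᴴ))) := by
    rw [mfun_eq hB]
    conv_lhs => rw [eq_eigU_conj hA]
    rw [Matrix.mul_assoc, Matrix.mul_assoc, trace_mul_comm]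
    simp only [Matrix.mul_assoc, conjTranspose_mul, conjTranspose_conjTranspose]
  rw [rtr, h]
  unfold overlap
  generalize (eigU hA)ᴴ * eigU hB = M
  rw [trace, Complex.re_sum]
  refine Finset.sum_congr rfl fun i _ => ?_
  rw [diag_apply, rdiag, diagonal_mul, Complex.re_ofReal_mul, Matrix.mul_apply, Complex.re_sum,
    Finset.mul_sum]
  refine Finset.sum_congr rfl fun j _ => ?_
  rw [rdiag, diagonal_mul]
  simp [Complex.normSq_apply]
  ring

lemma overlap_eq_zero_of_suppLE {A B : Matrix n n ℂ} (hA : A.IsHermitian) (hB : B.IsHermitian)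
    (hs : SuppLE A B) {i j : n} (hi : hA.eigenvalues i ≠ 0) (hj : hB.eigenvalues j = 0) :
    overlap hA hB i j = 0 := by
  have h1 : B.mulVec (fun k => eigU hB k j) = 0 := by
    have := hB.mulVec_eigenvectorBasis j
    rw [hj, zero_smul] at this
    exact this
  have h2 := hs _ h1
  have h3 : (rdiag hA.eigenvalues * ((eigU hA)ᴴ * eigU hB)) = (eigU hA)ᴴ * (A * eigU hB) := by
    rw [← Matrix.mul_assoc, ← Matrix.mul_assoc, eigU_star_mul_self hA]
  have h4 := congrFun (congrFun h3 i) j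
  rw [rdiag, diagonal_mul, Matrix.mul_apply (M := (eigU hA)ᴴ) (N := A * eigU hB)] at h4
  have h5 : ∀ k, (A * eigU hB) k j = 0 := fun k => congrFun h2 k
  simp only [h5, mul_zero, Finset.sum_const_zero] at h4
  rw [overlap, Complex.normSq_eq_zero]
  exact (mul_eq_zero.mp h4).resolve_left (by exact_mod_cast hi)

end Calculus

section RelEnt

open Matrix MeasureTheory Set Filter Topology

/-- The resolvent form `⟨A, (L_B + t R_A)⁻¹ A⟩`, whose integral over `t` gives relative entropy. -/
def resolventForm {A B : Matrix n n ℂ} (hA : A.IsHermitian) (hB : B.IsHermitian) (t : ℝ) : ℝ :=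
  ∑ i, ∑ j, overlap hA hB i j *
    (hA.eigenvalues i ^ 2 / (hB.eigenvalues j + t * hA.eigenvalues i))

/-- The concave quadratic functional of `X` whose maximum is the resolvent form. -/
def quadFun (A B : Matrix n n ℂ) (t : ℝ) (X : Matrix n n ℂ) : ℝ :=
  2 * rtr (Xᴴ * A) - rtr (Xᴴ * B * X) - t * rtr (X * A * Xᴴ)

omit [DecidableEq n] in
lemma rtr_sum_diag (M : Matrix n n ℂ) : rtr M = ∑ i, (M i i).re := by
  rw [rtr, trace, Complex.re_sum]; rfl

omit [DecidableEq n] in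
lemma rtr_mul_comm {m : Type*} [Fintype m] (M : Matrix n m ℂ)
    (P : Matrix m n ℂ) : rtr (M * P) = rtr (P * M) := by
  rw [rtr, rtr, trace_mul_comm]

lemma quadFun_conj {A B : Matrix n n ℂ} (hA : A.IsHermitian) (hB : B.IsHermitian) (t : ℝ)
    (Y : Matrix n n ℂ) :
    quadFun A B t (eigU hB * Y * (eigU hA)ᴴ) = ∑ i, ∑ j,
      (2 * hA.eigenvalues i * (Y j i * ((eigU hA)ᴴ * eigU hB) i j).re
        - (hB.eigenvalues j + t * hA.eigenvalues i) * Complex.normSq (Y j i)) := by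
  have h1 : rtr ((eigU hB * Y * (eigU hA)ᴴ)ᴴ * A) =
      ∑ i, ∑ j, hA.eigenvalues i * (Y j i * ((eigU hA)ᴴ * eigU hB) i j).re := by
    have : rtr ((eigU hB * Y * (eigU hA)ᴴ)ᴴ * A) =
        rtr (Yᴴ * ((eigU hA)ᴴ * eigU hB)ᴴ * rdiag hA.eigenvalues) := by
      rw [conjTranspose_mul, conjTranspose_mul, conjTranspose_conjTranspose, Matrix.mul_assoc,
        rtr_mul_comm, Matrix.mul_assoc, Matrix.mul_assoc, self_mul_eigU, conjTranspose_mul,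
        conjTranspose_conjTranspose]
      simp only [Matrix.mul_assoc]
    rw [this, rtr_sum_diag]
    refine Finset.sum_congr rfl fun i _ => ?_
    rw [rdiag, mul_diagonal, Matrix.mul_apply, mul_comm, Complex.re_ofReal_mul, Complex.re_sum,
      Finset.mul_sum]
    refine Finset.sum_congr rfl fun j _ => ?_
    simp [conjTranspose_apply]
  have h2 : rtr ((eigU hB * Y * (eigU hA)ᴴ)ᴴ * B * (eigU hB * Y * (eigU hA)ᴴ)) =
      ∑ i, ∑ j, hB.eigenvalues j * Complex.normSq (Y j i) := by
    have : rtr ((eigU hB * Y * (eigU hA)ᴴ)ᴴ * B * (eigU hB * Y * (eigU hA)ᴴ)) =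
        rtr (Yᴴ * (rdiag hB.eigenvalues * Y)) := by
      rw [conjTranspose_mul, conjTranspose_mul, conjTranspose_conjTranspose, Matrix.mul_assoc,
        Matrix.mul_assoc, rtr_mul_comm]
      simp only [Matrix.mul_assoc, eigU_star_mul, Matrix.mul_one]
      rw [← Matrix.mul_assoc B, self_mul_eigU]
      simp only [Matrix.mul_assoc, eigU_star_mul_assoc]
    rw [this, rtr_sum_diag]
    refine Finset.sum_congr rfl fun i _ => ?_
    rw [Matrix.mul_apply, Complex.re_sum]
    refine Finset.sum_congr rfl fun j _ => ?_
    rw [rdiag, diagonal_mul]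
    simp [conjTranspose_apply, Complex.normSq_apply]
    ring
  have h3 : rtr ((eigU hB * Y * (eigU hA)ᴴ) * A * (eigU hB * Y * (eigU hA)ᴴ)ᴴ) =
      ∑ i, ∑ j, hA.eigenvalues i * Complex.normSq (Y j i) := by
    have : rtr ((eigU hB * Y * (eigU hA)ᴴ) * A * (eigU hB * Y * (eigU hA)ᴴ)ᴴ) =
        rtr (rdiag hA.eigenvalues * (Yᴴ * Y)) := by
      rw [conjTranspose_mul, conjTranspose_mul, conjTranspose_conjTranspose, Matrix.mul_assoc,
        Matrix.mul_assoc, rtr_mul_comm]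
      simp only [Matrix.mul_assoc]
      rw [← Matrix.mul_assoc A, self_mul_eigU]
      simp only [Matrix.mul_assoc, eigU_star_mul_assoc]
    rw [this, rtr_sum_diag]
    refine Finset.sum_congr rfl fun i _ => ?_
    rw [rdiag, diagonal_mul, Complex.re_ofReal_mul, Matrix.mul_apply, Complex.re_sum,
      Finset.mul_sum]
    refine Finset.sum_congr rfl fun j _ => ?_
    simp [conjTranspose_apply, Complex.normSq_apply]
  rw [quadFun, h1, h2, h3]
  simp only [Finset.mul_sum, ← Finset.sum_sub_distrib]
  refine Finset.sum_congr rfl fun i _ => Finset.sum_congr rfl fun j _ => ?_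
  ring

lemma two_mul_re_sub_le {a c : ℝ} (hc : 0 ≤ c) (h : c = 0 → a = 0) (y w : ℂ) :
    2 * a * (y * w).re - c * Complex.normSq y ≤ Complex.normSq w * (a ^ 2 / c) := by
  rcases hc.eq_or_lt with h0 | h0
  · simp [h h0.symm, ← h0]
  · rw [← mul_div_assoc, le_div_iff₀ h0]
    simp only [Complex.normSq_apply, Complex.mul_re]
    nlinarith [sq_nonneg (a * w.re - c * y.re), sq_nonneg (a * w.im + c * y.im)]

lemma two_mul_re_sub_eq {a c : ℝ} (w : ℂ) :
    2 * a * ((((a / c : ℝ) : ℂ) * star w) * w).re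
      - c * Complex.normSq (((a / c : ℝ) : ℂ) * star w) = Complex.normSq w * (a ^ 2 / c) := by
  rcases eq_or_ne c 0 with h0 | h0
  · simp [h0]
  · rw [mul_assoc (_ : ℂ), Complex.re_ofReal_mul, RCLike.star_def, mul_comm _ w,
      Complex.mul_conj, Complex.normSq_mul, Complex.normSq_ofReal,
      Complex.normSq_conj, Complex.ofReal_re]
    field_simp
    ring

lemma quadFun_le {A B : Matrix n n ℂ} (hA : A.PosSemidef) (hB : B.PosSemidef) {t : ℝ}
    (ht : 0 < t) (X : Matrix n n ℂ) : quadFun A B t X ≤ resolventForm hA.1 hB.1 t := by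
  have hX : X = eigU hB.1 * ((eigU hB.1)ᴴ * X * eigU hA.1) * (eigU hA.1)ᴴ := by
    simp only [Matrix.mul_assoc, eigU_mul_star, Matrix.mul_one, eigU_mul_star_assoc]
  rw [hX, quadFun_conj]
  refine Finset.sum_le_sum fun i _ => Finset.sum_le_sum fun j _ => ?_
  have ha := hA.eigenvalues_nonneg i
  have hb := hB.eigenvalues_nonneg j
  refine two_mul_re_sub_le (by positivity) (fun h => ?_) _ _
  have h1 : t * hA.1.eigenvalues i = 0 := by nlinarith [mul_nonneg ht.le ha]
  exact (mul_eq_zero.mp h1).resolve_left ht.ne'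

lemma exists_quadFun_eq {A B : Matrix n n ℂ} (hA : A.IsHermitian) (hB : B.IsHermitian) (t : ℝ) :
    ∃ X, quadFun A B t X = resolventForm hA hB t := by
  refine ⟨eigU hB * (Matrix.of fun j i =>
    ((hA.eigenvalues i / (hB.eigenvalues j + t * hA.eigenvalues i) : ℝ) : ℂ)
      * star (((eigU hA)ᴴ * eigU hB) i j)) * (eigU hA)ᴴ, ?_⟩
  rw [quadFun_conj]
  refine Finset.sum_congr rfl fun i _ => Finset.sum_congr rfl fun j _ => ?_
  rw [Matrix.of_apply]
  exact two_mul_re_sub_eq _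

lemma integral_resolvent {a b : ℝ} (ha : 0 < a) (hb : 0 < b) :
    IntegrableOn (fun t => a ^ 2 / (b + t * a) - a / (1 + t)) (Ioi 0) ∧
      ∫ t in Ioi 0, (a ^ 2 / (b + t * a) - a / (1 + t)) = a * (Real.log a - Real.log b) := by
  have hd : ∀ t ∈ Ici (0 : ℝ), HasDerivAt
      (fun t => a * (Real.log (b + t * a) - Real.log (1 + t)))
      (a ^ 2 / (b + t * a) - a / (1 + t)) t := by
    intro t ht
    have ht : 0 ≤ t := ht
    have h1 : HasDerivAt (fun t : ℝ => b + t * a) a t := by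
      simpa using ((hasDerivAt_id t).mul_const a).const_add b
    have h2 : HasDerivAt (fun t : ℝ => 1 + t) 1 t := (hasDerivAt_id t).const_add 1
    exact (((h1.log (by positivity)).sub (h2.log (by positivity))).const_mul a).congr_deriv
      (by ring)
  have hlim : Tendsto (fun t => a * (Real.log (b + t * a) - Real.log (1 + t))) atTop
      (𝓝 (a * Real.log a)) := by
    refine Tendsto.const_mul a ?_
    have h1 : Tendsto (fun t : ℝ => a + (b - a) * (1 + t)⁻¹) atTop (𝓝 (a + (b - a) * 0)) := by
      refine tendsto_const_nhds.add (tendsto_const_nhds.mul ?_)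
      exact tendsto_inv_atTop_zero.comp (tendsto_atTop_add_const_left _ 1 tendsto_id)
    rw [mul_zero, add_zero] at h1
    have h2 := h1.log ha.ne'
    refine h2.congr' ?_
    filter_upwards [eventually_ge_atTop (0 : ℝ)] with t ht
    rw [← Real.log_div (by positivity) (by positivity)]
    congr 1
    field_simp
    ring
  have hs : ∀ t ∈ Ioi (0 : ℝ), a ^ 2 / (b + t * a) - a / (1 + t) =
      (a - b) * (a / ((b + t * a) * (1 + t))) := by
    intro t ht
    have ht : 0 < t := ht
    field_simp
    ring
  have hint : IntegrableOn (fun t => a ^ 2 / (b + t * a) - a / (1 + t)) (Ioi 0) := by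
    rcases le_total b a with hab | hab
    · refine integrableOn_Ioi_deriv_of_nonneg' hd (fun t ht => ?_) hlim
      have ht' : 0 < t := ht
      rw [hs t ht]
      exact mul_nonneg (sub_nonneg.mpr hab) (by positivity)
    · refine integrableOn_Ioi_deriv_of_nonpos' hd (fun t ht => ?_) hlim
      have ht' : 0 < t := ht
      rw [hs t ht]
      exact mul_nonpos_of_nonpos_of_nonneg (sub_nonpos.mpr hab) (by positivity)
  refine ⟨hint, ?_⟩
  rw [integral_Ioi_of_hasDerivAt_of_tendsto' hd hint hlim]
  simp
  ring

lemma relEnt_eq_sum {A B : Matrix n n ℂ} (hA : A.IsHermitian) (hB : B.IsHermitian) :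
    relEnt A B = ∑ i, ∑ j, overlap hA hB i j * (hA.eigenvalues i *
      (Real.logb 2 (hA.eigenvalues i) - Real.logb 2 (hB.eigenvalues j))) := by
  have h1 : rtr (A * mlog A) = ∑ i, ∑ j, overlap hA hB i j * (hA.eigenvalues i *
      Real.logb 2 (hA.eigenvalues i)) := by
    have h2 := mfun_mul_mfun hA (fun x => x) (Real.logb 2)
    rw [mfun_id hA] at h2
    rw [mlog, h2, rtr_mfun hA]
    refine Finset.sum_congr rfl fun i _ => ?_
    rw [← Finset.sum_mul, sum_overlap, one_mul]
  rw [relEnt, h1, mlog, rtr_mul_mfun hA hB, ← Finset.sum_sub_distrib]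
  refine Finset.sum_congr rfl fun i _ => ?_
  rw [← Finset.sum_sub_distrib]
  refine Finset.sum_congr rfl fun j _ => ?_
  ring

lemma relEnt_eq_integral {A B : Matrix n n ℂ} (hA : A.PosSemidef) (hB : B.PosSemidef)
    (hs : SuppLE A B) :
    IntegrableOn (fun t => resolventForm hA.1 hB.1 t - rtr A / (1 + t)) (Ioi 0) ∧
      ∫ t in Ioi 0, (resolventForm hA.1 hB.1 t - rtr A / (1 + t)) = Real.log 2 * relEnt A B := by
  have htr : rtr A = ∑ i, ∑ j, overlap hA.1 hB.1 i j * hA.1.eigenvalues i := by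
    have h2 := rtr_mfun hA.1 (fun x => x)
    rw [mfun_id hA.1] at h2
    rw [h2]
    refine Finset.sum_congr rfl fun i _ => ?_
    rw [← Finset.sum_mul, sum_overlap, one_mul]
  have hf : (fun t => resolventForm hA.1 hB.1 t - rtr A / (1 + t)) = fun t => ∑ i, ∑ j,
      overlap hA.1 hB.1 i j * (hA.1.eigenvalues i ^ 2 /
        (hB.1.eigenvalues j + t * hA.1.eigenvalues i) - hA.1.eigenvalues i / (1 + t)) := by
    funext t
    rw [resolventForm, htr, Finset.sum_div, ← Finset.sum_sub_distrib]
    refine Finset.sum_congr rfl fun i _ => ?_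
    rw [Finset.sum_div, ← Finset.sum_sub_distrib]
    refine Finset.sum_congr rfl fun j _ => ?_
    ring
  have key : ∀ i j, IntegrableOn (fun t => overlap hA.1 hB.1 i j * (hA.1.eigenvalues i ^ 2 /
        (hB.1.eigenvalues j + t * hA.1.eigenvalues i) - hA.1.eigenvalues i / (1 + t))) (Ioi 0) ∧
      ∫ t in Ioi 0, overlap hA.1 hB.1 i j * (hA.1.eigenvalues i ^ 2 /
        (hB.1.eigenvalues j + t * hA.1.eigenvalues i) - hA.1.eigenvalues i / (1 + t)) =
      Real.log 2 * (overlap hA.1 hB.1 i j * (hA.1.eigenvalues i *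
      (Real.logb 2 (hA.1.eigenvalues i) - Real.logb 2 (hB.1.eigenvalues j)))) := by
    intro i j
    rcases (hA.eigenvalues_nonneg i).eq_or_lt with h0 | h0
    · simp [← h0]
    rcases (hB.eigenvalues_nonneg j).eq_or_lt with h1 | h1
    · simp [overlap_eq_zero_of_suppLE hA.1 hB.1 hs h0.ne' h1.symm]
    obtain ⟨h2, h3⟩ := integral_resolvent h0 h1
    refine ⟨h2.const_mul _, ?_⟩
    rw [integral_const_mul, h3, Real.logb, Real.logb]
    have : Real.log 2 ≠ 0 := by positivity
    field_simp
  rw [hf]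
  refine ⟨integrable_finsetSum _ fun i _ => integrable_finsetSum _ fun j _ => (key i j).1, ?_⟩
  rw [integral_finsetSum _ fun i _ => integrable_finsetSum _ fun j _ => (key i j).1,
    relEnt_eq_sum hA.1 hB.1, Finset.mul_sum]
  refine Finset.sum_congr rfl fun i _ => ?_
  rw [integral_finsetSum _ fun j _ => (key i j).1, Finset.mul_sum]
  exact Finset.sum_congr rfl fun j _ => (key i j).2

end RelEnt

section Monotonicity

open Matrix MeasureTheory Set

variable {m e : Type*} [Fintype m] [DecidableEq m] [Fintype e] [DecidableEq e]

omit [DecidableEq n] in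
lemma rtr_mul_ptraceB (P : Matrix n n ℂ) (Z : Matrix (n × e) (n × e) ℂ) :
    rtr (P * ptraceB Z) = rtr ((P ⊗ₖ (1 : Matrix e e ℂ)) * Z) := by
  rw [rtr, rtr]
  congr 1
  simp only [trace, diag_apply, Matrix.mul_apply, Fintype.sum_prod_type, ptraceB, Matrix.of_apply,
    kroneckerMap_apply, Matrix.one_apply, mul_ite, mul_one, mul_zero, ite_mul, zero_mul,
    Finset.sum_ite_eq, Finset.mem_univ, if_true, Finset.mul_sum]
  exact Finset.sum_congr rfl fun i _ => Finset.sum_comm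

omit [DecidableEq n] in
lemma rtr_nonneg {P : Matrix n n ℂ} (hP : P.PosSemidef) : 0 ≤ rtr P :=
  (Complex.le_def.mp hP.trace_nonneg).1

omit [DecidableEq m] in
lemma rtr_range_proj_mul_le {W : Matrix n m ℂ} (hW : W * (Wᴴ * W) = W) {P : Matrix n n ℂ}
    (hP : P.PosSemidef) : rtr (W * Wᴴ * P) ≤ rtr P := by
  have hQ : (1 - W * Wᴴ) * (1 - W * Wᴴ) = 1 - W * Wᴴ := by
    have h : W * Wᴴ * (W * Wᴴ) = W * Wᴴ := by
      rw [← Matrix.mul_assoc, Matrix.mul_assoc W, hW]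
    rw [Matrix.sub_mul, Matrix.mul_sub, Matrix.mul_sub, h]
    simp
  have hH : (1 - W * Wᴴ)ᴴ = 1 - W * Wᴴ := by
    rw [conjTranspose_sub, conjTranspose_mul, conjTranspose_conjTranspose, conjTranspose_one]
  have h1 := rtr_nonneg (hP.mul_mul_conjTranspose_same (1 - W * Wᴴ))
  rw [rtr_mul_comm, hH, ← Matrix.mul_assoc, hQ, Matrix.sub_mul, Matrix.one_mul] at h1
  rw [rtr, trace_sub, Complex.sub_re] at h1
  exact sub_nonneg.mp h1

omit [DecidableEq m] in
lemma quadFun_le_quadFun {A B : Matrix n n ℂ} {A' B' : Matrix m m ℂ} (hA' : A'.PosSemidef)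
    (hB' : B'.PosSemidef) {W : Matrix (n × e) m ℂ} (hW : W * (Wᴴ * W) = W)
    (hA : A = ptraceB (W * A' * Wᴴ)) (hB : B = ptraceB (W * B' * Wᴴ)) {t : ℝ} (ht : 0 < t)
    (X : Matrix n n ℂ) :
    quadFun A B t X ≤ quadFun A' B' t (Wᴴ * (X ⊗ₖ (1 : Matrix e e ℂ)) * W) := by
  have hX : (X ⊗ₖ (1 : Matrix e e ℂ))ᴴ = Xᴴ ⊗ₖ (1 : Matrix e e ℂ) := by
    rw [conjTranspose_kronecker, conjTranspose_one]
  have hmul : ∀ P Q : Matrix n n ℂ, (P * Q) ⊗ₖ (1 : Matrix e e ℂ) =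
      (P ⊗ₖ (1 : Matrix e e ℂ)) * (Q ⊗ₖ (1 : Matrix e e ℂ)) := fun P Q => by
    rw [← mul_kronecker_mul, Matrix.one_mul]
  have h1 : rtr ((Wᴴ * (X ⊗ₖ (1 : Matrix e e ℂ)) * W)ᴴ * A') = rtr (Xᴴ * A) := by
    rw [hA, rtr_mul_ptraceB, ← hX]
    simp only [conjTranspose_mul, conjTranspose_conjTranspose, Matrix.mul_assoc]
    rw [rtr_mul_comm]
    simp only [Matrix.mul_assoc]
  have h2 : rtr ((Wᴴ * (X ⊗ₖ (1 : Matrix e e ℂ)) * W)ᴴ * B' *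
      (Wᴴ * (X ⊗ₖ (1 : Matrix e e ℂ)) * W)) ≤ rtr (Xᴴ * B * X) := by
    have h := rtr_range_proj_mul_le hW ((hB'.mul_mul_conjTranspose_same W).conjTranspose_mul_mul_same
      (X ⊗ₖ (1 : Matrix e e ℂ)))
    have hr : rtr (Xᴴ * B * X) = rtr ((X ⊗ₖ (1 : Matrix e e ℂ))ᴴ * (W * B' * Wᴴ) *
        (X ⊗ₖ (1 : Matrix e e ℂ))) := by
      rw [rtr_mul_comm (Xᴴ * B), ← Matrix.mul_assoc, hB, rtr_mul_ptraceB, hmul, ← hX,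
        Matrix.mul_assoc, rtr_mul_comm (X ⊗ₖ (1 : Matrix e e ℂ))]
    rw [hr]
    refine le_trans (le_of_eq ?_) h
    simp only [conjTranspose_mul, conjTranspose_conjTranspose, Matrix.mul_assoc]
    rw [rtr_mul_comm W]
    simp only [Matrix.mul_assoc]
  have h3 : rtr ((Wᴴ * (X ⊗ₖ (1 : Matrix e e ℂ)) * W) * A' *
      (Wᴴ * (X ⊗ₖ (1 : Matrix e e ℂ)) * W)ᴴ) ≤ rtr (X * A * Xᴴ) := by
    have h := rtr_range_proj_mul_le hW ((hA'.mul_mul_conjTranspose_same W).mul_mul_conjTranspose_same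
      (X ⊗ₖ (1 : Matrix e e ℂ)))
    have hr : rtr (X * A * Xᴴ) = rtr ((X ⊗ₖ (1 : Matrix e e ℂ)) * (W * A' * Wᴴ) *
        (X ⊗ₖ (1 : Matrix e e ℂ))ᴴ) := by
      rw [rtr_mul_comm (X * A), ← Matrix.mul_assoc, hA, rtr_mul_ptraceB, hmul, ← hX,
        Matrix.mul_assoc, rtr_mul_comm ((X ⊗ₖ (1 : Matrix e e ℂ))ᴴ)]
    rw [hr]
    refine le_trans (le_of_eq ?_) h
    simp only [conjTranspose_mul, conjTranspose_conjTranspose, Matrix.mul_assoc]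
    rw [rtr_mul_comm W]
    simp only [Matrix.mul_assoc]
  rw [quadFun, quadFun, h1]
  have := mul_le_mul_of_nonneg_left h3 ht.le
  linarith

/-- Monotonicity of relative entropy under conjugation by a partial isometry followed by a
partial trace, provided that the trace of the first argument is preserved. -/
lemma relEnt_le_relEnt {A B : Matrix n n ℂ} {A' B' : Matrix m m ℂ} (hA : A.PosSemidef)
    (hB : B.PosSemidef) (hs : SuppLE A B) (hA' : A'.PosSemidef) (hB' : B'.PosSemidef)
    (hs' : SuppLE A' B') {W : Matrix (n × e) m ℂ} (hW : W * (Wᴴ * W) = W)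
    (hAW : A = ptraceB (W * A' * Wᴴ)) (hBW : B = ptraceB (W * B' * Wᴴ)) (htr : rtr A = rtr A') :
    relEnt A B ≤ relEnt A' B' := by
  obtain ⟨h1, h2⟩ := relEnt_eq_integral hA hB hs
  obtain ⟨h3, h4⟩ := relEnt_eq_integral hA' hB' hs'
  refine le_of_mul_le_mul_left ?_ (Real.log_pos one_lt_two)
  rw [← h2, ← h4]
  refine setIntegral_mono_on h1 h3 measurableSet_Ioi fun t ht => ?_
  rw [htr]
  refine sub_le_sub_right ?_ _
  obtain ⟨X, hX⟩ := exists_quadFun_eq hA.1 hB.1 t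
  rw [← hX]
  exact (quadFun_le_quadFun hA' hB' hW hAW hBW ht X).trans (quadFun_le hA' hB' ht _)

end Monotonicity

section ConditionalEntropy

open Matrix

lemma mfun_smul_one_kronecker {σ : Matrix r r ℂ} (hσ : σ.IsHermitian) (c : ℝ) (f : ℝ → ℝ) :
    mfun f (((c : ℂ) • (1 : Matrix b b ℂ)) ⊗ₖ σ) =
      (1 : Matrix b b ℂ) ⊗ₖ mfun (fun x => f (c * x)) σ := by
  have hH : (((c : ℂ) • (1 : Matrix b b ℂ)) ⊗ₖ σ).IsHermitian := by
    rw [Matrix.IsHermitian, conjTranspose_kronecker, conjTranspose_smul, conjTranspose_one, hσ.eq]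
    simp
  ext ⟨p, i⟩ ⟨k, j⟩
  let X : Matrix (b × r) r ℂ :=
    Matrix.of fun q j => if q.1 = k then (1 : Matrix r r ℂ) q.2 j else 0
  have hL : ∀ (M : Matrix (b × r) (b × r) ℂ) q j, (M * X) q j = M q (k, j) := fun M q j => by
    simp [X, Matrix.mul_apply, Fintype.sum_prod_type, Matrix.one_apply]
  have hR : ∀ (S : Matrix r r ℂ) q j, (X * S) q j = if q.1 = k then S q.2 j else 0 :=
    fun S q j => by
      by_cases h : q.1 = k <;> simp [X, Matrix.mul_apply, Matrix.one_apply, h]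
  have h : (((c : ℂ) • (1 : Matrix b b ℂ)) ⊗ₖ σ) * X = X * mfun (fun x => c * x) σ := by
    ext q j
    rw [hL, hR, mfun_smul hσ]
    simp [kroneckerMap_apply, Matrix.one_apply]
  have h2 := congrFun (congrFun (mfun_intertwine hH hσ f _ h) (p, i)) j
  rw [hL, hR] at h2
  rw [h2]
  simp [kroneckerMap_apply, Matrix.one_apply]

omit [DecidableEq r] in
lemma rtr_mul_one_kronecker (ρ : Matrix (b × r) (b × r) ℂ) (S : Matrix r r ℂ) :
    rtr (ρ * ((1 : Matrix b b ℂ) ⊗ₖ S)) = rtr (ptraceA ρ * S) := by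
  rw [rtr, rtr]
  congr 1
  simp only [trace, diag_apply, Matrix.mul_apply, Fintype.sum_prod_type, ptraceA, Matrix.of_apply,
    kroneckerMap_apply, Matrix.one_apply, mul_ite, mul_zero, ite_mul, zero_mul, one_mul,
    Finset.sum_mul]
  rw [Finset.sum_comm]
  refine Finset.sum_congr rfl fun i _ => ?_
  trans ∑ x, ∑ j, ρ (x, i) (x, j) * S j i
  · refine Finset.sum_congr rfl fun x _ => ?_
    rw [Finset.sum_comm]
    simp
  · exact Finset.sum_comm

omit [Fintype r] [DecidableEq r] [DecidableEq b] in
lemma ptraceA_eq_sum (ρ : Matrix (b × r) (b × r) ℂ) :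
    ptraceA ρ = ∑ k, ρ.submatrix (fun i => (k, i)) (fun i => (k, i)) := by
  ext i j
  simp [ptraceA, Matrix.sum_apply]

omit [Fintype r] [DecidableEq r] [DecidableEq b] in
lemma ptraceA_posSemidef {ρ : Matrix (b × r) (b × r) ℂ} (hρ : ρ.PosSemidef) :
    (ptraceA ρ).PosSemidef := by
  rw [ptraceA_eq_sum]
  exact posSemidef_sum _ fun k _ => hρ.submatrix _

omit [DecidableEq r] [DecidableEq b] in
lemma rtr_ptraceA (ρ : Matrix (b × r) (b × r) ℂ) : rtr (ptraceA ρ) = rtr ρ := by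
  rw [rtr, rtr]
  congr 1
  simp only [trace, diag_apply, Fintype.sum_prod_type, ptraceA, Matrix.of_apply]
  exact Finset.sum_comm

/-- The relative entropy to `c • 1 ⊗ ρ_R` in terms of the conditional entropy. -/
lemma relEnt_smul_one_kronecker {ρ : Matrix (b × r) (b × r) ℂ} (hρ : ρ.PosSemidef) {c : ℝ}
    (hc : 0 < c) :
    relEnt ρ (((c : ℂ) • (1 : Matrix b b ℂ)) ⊗ₖ ptraceA ρ) =
      - condvnEnt ρ - rtr ρ * Real.logb 2 c := by
  have hR := (ptraceA_posSemidef hρ).1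
  have h : rtr (ptraceA ρ * mfun (fun x => Real.logb 2 (c * x)) (ptraceA ρ)) =
      rtr (ptraceA ρ * mlog (ptraceA ρ)) + rtr ρ * Real.logb 2 c := by
    have h1 := fun f : ℝ → ℝ => mfun_mul_mfun hR (fun x => x) f
    have h2 := rtr_mfun hR (fun x => x)
    simp only [mfun_id hR] at h1 h2
    rw [← rtr_ptraceA, mlog, h1, h1, rtr_mfun hR, rtr_mfun hR, h2, Finset.sum_mul,
      ← Finset.sum_add_distrib]
    refine Finset.sum_congr rfl fun i _ => ?_
    rcases eq_or_ne (hR.eigenvalues i) 0 with h0 | h0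
    · simp [h0]
    · rw [Real.logb_mul hc.ne' h0]
      ring
  rw [relEnt, mlog, mlog, mfun_smul_one_kronecker hR, rtr_mul_one_kronecker, h, condvnEnt, vnEnt,
    vnEnt, ← mlog]
  ring

omit [DecidableEq r] in
lemma suppLE_one_kronecker_ptraceA {ρ : Matrix (b × r) (b × r) ℂ} (hρ : ρ.PosSemidef) :
    SuppLE ρ ((1 : Matrix b b ℂ) ⊗ₖ ptraceA ρ) := by
  intro v hv
  have hv' : ∀ p, (ptraceA ρ).mulVec (fun i => v (p, i)) = 0 := fun p => by
    ext i
    have := congrFun hv (p, i)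
    simpa [Matrix.mulVec, dotProduct, Fintype.sum_prod_type, kroneckerMap_apply,
      Matrix.one_apply, ite_mul] using this
  have hk : ∀ p k, (ρ.submatrix (fun i => (k, i)) (fun i => (k, i))).mulVec
      (fun i => v (p, i)) = 0 := fun p k => by
    have h0 : ∀ k, 0 ≤ star (fun i => v (p, i)) ⬝ᵥ
        (ρ.submatrix (fun i => (k, i)) (fun i => (k, i))).mulVec (fun i => v (p, i)) :=
      fun k => (hρ.submatrix _).dotProduct_mulVec_nonneg _
    have hsum : ∑ k, star (fun i => v (p, i)) ⬝ᵥ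
        (ρ.submatrix (fun i => (k, i)) (fun i => (k, i))).mulVec (fun i => v (p, i)) = 0 := by
      rw [← dotProduct_sum, ← Matrix.sum_mulVec, ← ptraceA_eq_sum, hv' p, dotProduct_zero]
    exact ((hρ.submatrix _).dotProduct_mulVec_zero_iff _).mp
      ((Finset.sum_eq_zero_iff_of_nonneg fun k _ => h0 k).mp hsum k (Finset.mem_univ k))
  have hz : ∀ p, ρ.mulVec (fun q => if q.1 = p then v (p, q.2) else 0) = 0 := fun p => by
    rw [← hρ.dotProduct_mulVec_zero_iff]
    have := congrArg (fun w => star (fun i => v (p, i)) ⬝ᵥ w) (hk p p)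
    simpa [dotProduct, Matrix.mulVec, Fintype.sum_prod_type, apply_ite, ite_mul, mul_ite,
      Finset.sum_ite_irrel] using this
  have hdecomp : v = ∑ p, fun q : b × r => if q.1 = p then v (p, q.2) else 0 := by
    ext ⟨p, i⟩
    simp
  rw [hdecomp, Matrix.mulVec_sum]
  exact Finset.sum_eq_zero fun p _ => hz p

end ConditionalEntropy

section Channels

open Matrix

variable {r' e : Type*} [Fintype r'] [DecidableEq r'] [Fintype e] [DecidableEq e]

omit [Fintype a] [DecidableEq a] [Fintype b] [DecidableEq b] in
lemma tensorId_apply (N : Matrix a a ℂ →ₗ[ℂ] Matrix b b ℂ) (ρ : Matrix (a × r) (a × r) ℂ)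
    (p q : b × r) :
    tensorId N r ρ p q = N (Matrix.of fun x y => ρ (x, p.2) (y, q.2)) p.1 q.1 := rfl

omit [Fintype b] [DecidableEq b] in
lemma tensorId_replacer (σ : Matrix b b ℂ) (ρ : Matrix (a × r) (a × r) ℂ) :
    tensorId (replacer a σ) r ρ = σ ⊗ₖ ptraceA ρ := by
  ext p q
  simp [tensorId_apply, replacer, kroneckerMap_apply, ptraceA, trace, mul_comm]

omit [DecidableEq a] [DecidableEq b] in
lemma ptraceA_tensorId {N : Matrix a a ℂ →ₗ[ℂ] Matrix b b ℂ} (hN : IsChannel N)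
    (ρ : Matrix (a × r) (a × r) ℂ) : ptraceA (tensorId N r ρ) = ptraceA ρ := by
  ext i j
  exact hN.1 (Matrix.of fun x y => ρ (x, i) (y, j))

omit [DecidableEq a] [DecidableEq b] in
lemma tensorId_posSemidef {N : Matrix a a ℂ →ₗ[ℂ] Matrix b b ℂ} (hN : IsChannel N)
    {ρ : Matrix (a × r) (a × r) ℂ} (hρ : ρ.PosSemidef) : (tensorId N r ρ).PosSemidef := by
  let f := Fintype.equivFin r
  have h := hN.2 _ _ (hρ.submatrix (Prod.map id f.symm))
  have h2 := h.submatrix (Prod.map id f)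
  convert h2 using 1
  ext p q
  simp [tensorId_apply]

omit [DecidableEq a] [DecidableEq b] in
lemma tensorId_isState {N : Matrix a a ℂ →ₗ[ℂ] Matrix b b ℂ} (hN : IsChannel N)
    {ρ : Matrix (a × r) (a × r) ℂ} (hρ : IsState ρ) : IsState (tensorId N r ρ) := by
  refine ⟨tensorId_posSemidef hN hρ.1, ?_⟩
  rw [← hρ.2]
  simp only [trace, diag_apply, Fintype.sum_prod_type]
  rw [Finset.sum_comm, Finset.sum_comm (s := (Finset.univ : Finset a))]
  exact Finset.sum_congr rfl fun i _ => hN.1 (Matrix.of fun x y => ρ (x, i) (y, i))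

omit [DecidableEq r] [DecidableEq b] in
lemma ptraceA_isState {ρ : Matrix (b × r) (b × r) ℂ} (hρ : IsState ρ) : IsState (ptraceA ρ) := by
  refine ⟨ptraceA_posSemidef hρ.1, ?_⟩
  rw [← hρ.2]
  simp only [trace, diag_apply, Fintype.sum_prod_type, ptraceA, Matrix.of_apply]
  exact Finset.sum_comm

/-- The matrix `1 ⊗ w`, with its row index regrouped. -/
def liftRef (b : Type*) [DecidableEq b] (w : Matrix (r × e) r' ℂ) :
    Matrix ((b × r) × e) (b × r') ℂ :=
  ((1 : Matrix b b ℂ) ⊗ₖ w).submatrix (Equiv.prodAssoc b r e) id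

omit [DecidableEq r] [DecidableEq r'] [DecidableEq e] in
lemma liftRef_mul_conjTranspose_mul {w : Matrix (r × e) r' ℂ} (hw : w * (wᴴ * w) = w) :
    liftRef b w * ((liftRef b w)ᴴ * liftRef b w) = liftRef b w := by
  rw [liftRef, conjTranspose_submatrix, submatrix_mul_equiv, submatrix_id_id,
    conjTranspose_kronecker, ← mul_kronecker_mul, conjTranspose_one, Matrix.one_mul]
  conv_rhs => rw [← hw, ← Matrix.one_mul (1 : Matrix b b ℂ), mul_kronecker_mul]
  rfl

omit [Fintype r] [DecidableEq r] [DecidableEq r'] [Fintype e] [DecidableEq e] in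
lemma liftRef_mul_apply (w : Matrix (r × e) r' ℂ) {m : Type*} (Z : Matrix (b × r') m ℂ)
    (p : b) (i : r) (k : e) (q : m) :
    (liftRef b w * Z) ((p, i), k) q = ∑ y, w (i, k) y * Z (p, y) q := by
  simp [liftRef, Matrix.mul_apply, Fintype.sum_prod_type, kroneckerMap_apply, Matrix.one_apply,
    ite_mul, Finset.sum_ite_irrel]

omit [Fintype r] [DecidableEq r] [DecidableEq r'] [Fintype e] [DecidableEq e] in
lemma mul_liftRef_conjTranspose_apply (w : Matrix (r × e) r' ℂ) {m : Type*}
    (Z : Matrix m (b × r') ℂ) (p : b) (i : r) (k : e) (q : m) :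
    (Z * (liftRef b w)ᴴ) q ((p, i), k) = ∑ y, Z q (p, y) * star (w (i, k) y) := by
  simp [liftRef, Matrix.mul_apply, Fintype.sum_prod_type, kroneckerMap_apply, Matrix.one_apply,
    Finset.sum_ite_irrel, apply_ite]

omit [Fintype a] [DecidableEq a] [DecidableEq e] in
lemma ptraceB_conj_tensorId (N : Matrix a a ℂ →ₗ[ℂ] Matrix b b ℂ) {w : Matrix (r × e) r' ℂ}
    {ρ : Matrix (a × r) (a × r) ℂ} {ρ' : Matrix (a × r') (a × r') ℂ}
    (h : ∀ x x' i j, ρ (x, i) (x', j) =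
      ∑ k, ∑ y', ∑ y, (w (i, k) y * star (w (j, k) y')) * ρ' (x, y) (x', y')) :
    tensorId N r ρ = ptraceB (liftRef b w * tensorId N r' ρ' * (liftRef b w)ᴴ) := by
  ext ⟨p, i⟩ ⟨q, j⟩
  have hblock : (Matrix.of fun x y => ρ (x, i) (y, j)) = ∑ k, ∑ y', ∑ y,
      (w (i, k) y * star (w (j, k) y')) • (Matrix.of fun x x' => ρ' (x, y) (x', y')) := by
    ext x x'
    simp only [Matrix.sum_apply, Matrix.smul_apply, Matrix.of_apply, smul_eq_mul]
    exact h x x' i j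
  rw [tensorId_apply, hblock]
  simp only [map_sum, map_smul, Matrix.sum_apply, Matrix.smul_apply, smul_eq_mul, ptraceB,
    Matrix.of_apply, mul_liftRef_conjTranspose_apply, liftRef_mul_apply, Finset.sum_mul]
  refine Finset.sum_congr rfl fun k _ => Finset.sum_congr rfl fun y' _ =>
    Finset.sum_congr rfl fun y _ => ?_
  rw [tensorId_apply]
  ring

lemma condvnEnt_tensorId_le {N : Matrix a a ℂ →ₗ[ℂ] Matrix b b ℂ} (hN : IsChannel N)
    {w : Matrix (r × e) r' ℂ} (hw : w * (wᴴ * w) = w) {ρ : Matrix (a × r) (a × r) ℂ}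
    {ρ' : Matrix (a × r') (a × r') ℂ} (hρ : IsState ρ) (hρ' : IsState ρ')
    (h : ∀ x x' i j, ρ (x, i) (x', j) =
      ∑ k, ∑ y', ∑ y, (w (i, k) y * star (w (j, k) y')) * ρ' (x, y) (x', y')) :
    condvnEnt (tensorId N r' ρ') ≤ condvnEnt (tensorId N r ρ) := by
  have hs := tensorId_isState hN hρ
  have hs' := tensorId_isState hN hρ'
  have key : relEnt (tensorId N r ρ) ((1 : Matrix b b ℂ) ⊗ₖ ptraceA (tensorId N r ρ)) ≤
      relEnt (tensorId N r' ρ') ((1 : Matrix b b ℂ) ⊗ₖ ptraceA (tensorId N r' ρ')) := by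
    refine relEnt_le_relEnt hs.1 (PosSemidef.one.kronecker (ptraceA_posSemidef hs.1))
      (suppLE_one_kronecker_ptraceA hs.1) hs'.1
      (PosSemidef.one.kronecker (ptraceA_posSemidef hs'.1))
      (suppLE_one_kronecker_ptraceA hs'.1) (liftRef_mul_conjTranspose_mul hw)
      (ptraceB_conj_tensorId N h) ?_ (by rw [rtr, rtr, hs.2, hs'.2])
    rw [ptraceA_tensorId hN, ptraceA_tensorId hN, ← tensorId_replacer, ← tensorId_replacer]
    exact ptraceB_conj_tensorId _ h
  have h1 := relEnt_smul_one_kronecker hs.1 one_pos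
  have h2 := relEnt_smul_one_kronecker hs'.1 one_pos
  simp only [Complex.ofReal_one, one_smul, Real.logb_one, mul_zero, sub_zero] at h1 h2
  rw [h1, h2] at key
  linarith

lemma exists_isPureState_condvnEnt_le {N : Matrix a a ℂ →ₗ[ℂ] Matrix b b ℂ} (hN : IsChannel N)
    {ρ : Matrix (a × r) (a × r) ℂ} (hρ : IsState ρ) :
    ∃ ψ : Matrix (a × a) (a × a) ℂ, IsPureState ψ ∧
      condvnEnt (tensorId N a ψ) ≤ condvnEnt (tensorId N r ρ) := by
  set S := mfun Real.sqrt ρ with hS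
  have hSS : S * Sᴴ = ρ := by
    rw [hS, mfun_conjTranspose hρ.1.1, mfun_mul_mfun hρ.1.1]
    refine (mfun_congr hρ.1.1 fun i => ?_).trans (mfun_id hρ.1.1)
    exact Real.mul_self_sqrt (hρ.1.eigenvalues_nonneg i)
  let M : Matrix (r × (a × r)) a ℂ := Matrix.of fun p x => S (x, p.1) p.2
  have hG : (Mᴴ * M).PosSemidef := posSemidef_conjTranspose_mul_self M
  set H := mfun Real.sqrt (Mᴴ * M) with hH
  set K := mfun (fun x => (Real.sqrt x)⁻¹) (Mᴴ * M) with hK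
  have hHH : Hᴴ * H = Mᴴ * M := by
    rw [hH, mfun_conjTranspose hG.1, mfun_mul_mfun hG.1]
    refine (mfun_congr hG.1 fun i => ?_).trans (mfun_id hG.1)
    exact Real.mul_self_sqrt (hG.eigenvalues_nonneg i)
  have hMKH : M * (K * H) = M := by
    have h0 : M * (1 - K * H) = 0 := by
      have hsub : 1 - K * H = mfun (fun x => 1 - (Real.sqrt x)⁻¹ * Real.sqrt x) (Mᴴ * M) := by
        rw [← mfun_sub hG.1, mfun_one hG.1, hK, hH, mfun_mul_mfun hG.1]
      rw [← conjTranspose_mul_self_eq_zero, conjTranspose_mul, Matrix.mul_assoc,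
        ← Matrix.mul_assoc Mᴴ, hsub, mfun_conjTranspose hG.1]
      have h1 := mfun_mul_mfun hG.1 (fun x => x) (fun x => 1 - (Real.sqrt x)⁻¹ * Real.sqrt x)
      rw [mfun_id hG.1] at h1
      rw [h1, mfun_mul_mfun hG.1]
      refine (mfun_congr hG.1 fun i => ?_).trans (mfun_zero hG.1)
      rcases (hG.eigenvalues_nonneg i).eq_or_lt with h | h
      · simp [← h]
      · rw [inv_mul_cancel₀ (Real.sqrt_pos.mpr h).ne']
        simp
    rw [Matrix.mul_sub, Matrix.mul_one, sub_eq_zero] at h0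
    exact h0.symm
  have hw : (M * K) * ((M * K)ᴴ * (M * K)) = M * K := by
    have h1 := mfun_mul_mfun hG.1 (fun x => x) (fun x => (Real.sqrt x)⁻¹)
    rw [mfun_id hG.1, ← hK] at h1
    rw [conjTranspose_mul, Matrix.mul_assoc, Matrix.mul_assoc, ← Matrix.mul_assoc Mᴴ, h1, hK,
      mfun_conjTranspose hG.1, mfun_mul_mfun hG.1, mfun_mul_mfun hG.1]
    congr 1
    refine mfun_congr hG.1 fun i => ?_
    rcases (hG.eigenvalues_nonneg i).eq_or_lt with h | h
    · simp [← h]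
    · have h2 := (Real.sqrt_pos.mpr h).ne'
      field_simp
      rw [Real.sq_sqrt h.le]
  let v : a × a → ℂ := fun p => H p.2 p.1
  have hψtr : trace (vecMulVec v (star v)) = 1 := by
    have h1 : trace (vecMulVec v (star v)) = trace (Hᴴ * H) := by
      simp only [trace, diag_apply, vecMulVec_apply, Fintype.sum_prod_type, Matrix.mul_apply,
        conjTranspose_apply, Pi.star_apply, v]
      exact Finset.sum_congr rfl fun x _ => Finset.sum_congr rfl fun y _ => mul_comm _ _
    have h2 : trace (Mᴴ * M) = trace (S * Sᴴ) := by
      simp only [trace, diag_apply, Fintype.sum_prod_type, Matrix.mul_apply, conjTranspose_apply,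
        M, Matrix.of_apply]
      exact Finset.sum_congr rfl fun x _ => Finset.sum_congr rfl fun y _ =>
        Finset.sum_congr rfl fun z _ => Finset.sum_congr rfl fun z' _ => mul_comm _ _
    rw [h1, hHH, h2, hSS, hρ.2]
  have hψ : IsState (vecMulVec v (star v)) := ⟨posSemidef_vecMulVec_self_star v, hψtr⟩
  refine ⟨vecMulVec v (star v), ⟨hψ, ?_⟩, condvnEnt_tensorId_le hN hw hρ hψ ?_⟩
  · refine le_antisymm (rank_vecMulVec_le _ _) (Nat.one_le_iff_ne_zero.mpr fun h0 => ?_)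
    have hz : vecMulVec v (star v) = 0 := by
      rw [hψ.1.1.rank_eq_card_non_zero_eigs, Fintype.card_eq_zero_iff] at h0
      rw [← mfun_id hψ.1.1]
      refine (mfun_congr hψ.1.1 fun i => ?_).trans (mfun_zero hψ.1.1)
      by_contra hi
      exact h0.false ⟨i, hi⟩
    rw [hz, trace_zero] at hψtr
    exact zero_ne_one hψtr
  · intro x x' i j
    have hwH : (M * K) * H = M := by rw [Matrix.mul_assoc, hMKH]
    have hent : ∀ (l : r) k z, S (z, l) k = ∑ y, (M * K) (l, k) y * H y z := fun l k z => by
      have := congrFun (congrFun hwH (l, k)) z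
      rw [Matrix.mul_apply] at this
      exact this.symm
    conv_lhs => rw [← hSS]
    rw [Matrix.mul_apply]
    refine Finset.sum_congr rfl fun k _ => ?_
    rw [conjTranspose_apply, hent i k x, hent j k x', star_sum, Finset.mul_sum]
    refine Finset.sum_congr rfl fun y' _ => ?_
    rw [Finset.sum_mul]
    refine Finset.sum_congr rfl fun y _ => ?_
    simp only [star_mul', vecMulVec_apply, Pi.star_apply, v]
    ring

lemma vnEnt_eq_sum {ρ : Matrix n n ℂ} (hρ : ρ.IsHermitian) :
    vnEnt ρ = ∑ i, -(hρ.eigenvalues i * Real.logb 2 (hρ.eigenvalues i)) := by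
  have h := mfun_mul_mfun hρ (fun x => x) (Real.logb 2)
  rw [mfun_id hρ] at h
  rw [vnEnt, mlog, h, rtr_mfun hρ, Finset.sum_neg_distrib]

lemma sum_eigenvalues_of_isState {ρ : Matrix n n ℂ} (hρ : IsState ρ) :
    ∑ i, hρ.1.1.eigenvalues i = 1 := by
  rw [← rtr_mfun hρ.1.1 (fun x => x), mfun_id hρ.1.1, rtr, hρ.2, Complex.one_re]

lemma vnEnt_nonneg {ρ : Matrix n n ℂ} (hρ : IsState ρ) : 0 ≤ vnEnt ρ := by
  rw [vnEnt_eq_sum hρ.1.1]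
  refine Finset.sum_nonneg fun i _ => ?_
  have h0 := hρ.1.eigenvalues_nonneg
  have h1 : hρ.1.1.eigenvalues i ≤ 1 := by
    rw [← sum_eigenvalues_of_isState hρ]
    exact Finset.single_le_sum (fun j _ => h0 j) (Finset.mem_univ i)
  exact neg_nonneg.mpr (mul_nonpos_of_nonneg_of_nonpos (h0 i)
    (Real.logb_nonpos one_lt_two (h0 i) h1))

lemma vnEnt_le {ρ : Matrix n n ℂ} (hρ : IsState ρ) :
    vnEnt ρ ≤ Fintype.card n * (Real.log 2)⁻¹ := by
  rw [vnEnt_eq_sum hρ.1.1, ← nsmul_eq_mul]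
  refine Finset.sum_le_card_nsmul _ _ _ fun i _ => ?_
  have h2 : 0 < Real.log 2 := Real.log_pos one_lt_two
  rcases (hρ.1.eigenvalues_nonneg i).eq_or_lt with h | h
  · rw [← h]; simp [h2.le]
  · rw [Real.logb, ← mul_div_assoc, ← neg_div, div_eq_mul_inv]
    refine mul_le_of_le_one_left (inv_pos.mpr h2).le ?_
    have h3 := mul_le_mul_of_nonneg_left (Real.one_sub_inv_le_log_of_pos h) h.le
    rw [mul_sub, mul_inv_cancel₀ h.ne'] at h3
    linarith

lemma neg_card_mul_le_condvnEnt {ρ : Matrix (b × r) (b × r) ℂ} (hρ : IsState ρ) :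
    -(Fintype.card r * (Real.log 2)⁻¹) ≤ condvnEnt ρ := by
  have h1 := vnEnt_nonneg hρ
  have h2 := vnEnt_le (ptraceA_isState hρ)
  rw [condvnEnt]
  linarith

lemma relEnt_tensorId_randomizing [Nonempty b] {N : Matrix a a ℂ →ₗ[ℂ] Matrix b b ℂ}
    (hN : IsChannel N) {ρ : Matrix (a × r) (a × r) ℂ} (hρ : IsState ρ) :
    relEnt (tensorId N r ρ) (tensorId (randomizing a b) r ρ) =
      Real.logb 2 (Fintype.card b) - condvnEnt (tensorId N r ρ) := by
  have hs := tensorId_isState hN hρ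
  have hc : (0 : ℝ) < (Fintype.card b : ℝ)⁻¹ := by
    have : 0 < Fintype.card b := Fintype.card_pos
    positivity
  have h := relEnt_smul_one_kronecker hs.1 hc
  have h2 : tensorId (randomizing a b) r ρ = maxMixed b ⊗ₖ ptraceA ρ :=
    tensorId_replacer (maxMixed b) ρ
  rw [ptraceA_tensorId hN, Complex.ofReal_inv, Complex.ofReal_natCast] at h
  rw [h2, maxMixed, h, rtr, hs.2, Real.logb_inv, Complex.one_re]
  ring

lemma exists_isState [Nonempty n] : ∃ ρ : Matrix n n ℂ, IsState ρ := by
  obtain ⟨i⟩ := ‹Nonempty n›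
  refine ⟨vecMulVec (Pi.single i 1) (star (Pi.single i 1)), posSemidef_vecMulVec_self_star _, ?_⟩
  simp [trace_vecMulVec]

lemma condvnEnt_tensorId_reindex_le {N : Matrix a a ℂ →ₗ[ℂ] Matrix b b ℂ} (hN : IsChannel N)
    (f : r' ≃ r) {ρ : Matrix (a × r) (a × r) ℂ} (hρ : IsState ρ) :
    ∃ ρ' : Matrix (a × r') (a × r') ℂ, IsState ρ' ∧
      condvnEnt (tensorId N r' ρ') ≤ condvnEnt (tensorId N r ρ) := by
  have hρ' : IsState (ρ.submatrix (Prod.map id f : a × r' → a × r) (Prod.map id f)) := by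
    refine ⟨hρ.1.submatrix _, ?_⟩
    rw [← hρ.2]
    exact Fintype.sum_equiv (Equiv.prodCongr (Equiv.refl a) f) _ _ fun _ => rfl
  let w : Matrix (r × Unit) r' ℂ := (1 : Matrix r' r' ℂ).submatrix ((Equiv.prodPUnit r).trans f.symm) id
  refine ⟨_, hρ', condvnEnt_tensorId_le hN (w := w) ?_ hρ hρ' ?_⟩
  · have h : wᴴ * w = 1 := by
      rw [conjTranspose_submatrix, Matrix.submatrix_mul_equiv, conjTranspose_one, Matrix.one_mul,
        submatrix_id_id]
    rw [h, Matrix.mul_one]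
  · intro x x' i j
    simp [w, Matrix.one_apply]

end Channels

theorem chEnt_eq_iInf_condvnEnt {A B : Type} [Fintype A] [DecidableEq A] [Nonempty A]
    [Fintype B] [DecidableEq B] [Nonempty B]
    (N : Matrix A A ℂ →ₗ[ℂ] Matrix B B ℂ) (hN : IsChannel N) :
    chEnt N = ⨅ ψ : {ψ : Matrix (A × A) (A × A) ℂ // IsPureState ψ},
      condvnEnt (tensorId N A ψ.1) := by
  have hbdd : BddBelow (Set.range fun ψ : {ψ : Matrix (A × A) (A × A) ℂ // IsPureState ψ} =>
      condvnEnt (tensorId N A ψ.1)) := by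
    refine ⟨-(Fintype.card A * (Real.log 2)⁻¹), ?_⟩
    rintro _ ⟨ψ, rfl⟩
    exact neg_card_mul_le_condvnEnt (tensorId_isState hN ψ.2.1)
  have hrel : chRelEnt N (randomizing A B) =
      ⨆ p : Σ k : ℕ, {ρ : Matrix (A × Fin k) (A × Fin k) ℂ // IsState ρ},
        (Real.logb 2 (Fintype.card B) - condvnEnt (tensorId N (Fin p.1) p.2.1)) :=
    iSup_congr fun p => relEnt_tensorId_randomizing hN p.2.2
  have hle : ∀ p : Σ k : ℕ, {ρ : Matrix (A × Fin k) (A × Fin k) ℂ // IsState ρ},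
      Real.logb 2 (Fintype.card B) - condvnEnt (tensorId N (Fin p.1) p.2.1) ≤
        Real.logb 2 (Fintype.card B) - ⨅ ψ : {ψ : Matrix (A × A) (A × A) ℂ // IsPureState ψ},
          condvnEnt (tensorId N A ψ.1) := by
    intro p
    obtain ⟨ψ, hψ, h⟩ := exists_isPureState_condvnEnt_le hN p.2.2
    exact sub_le_sub_left ((ciInf_le hbdd ⟨ψ, hψ⟩).trans h) _
  obtain ⟨ρ₀, hρ₀⟩ := exists_isState (n := A × A)
  obtain ⟨ψ₀, hψ₀, -⟩ := exists_isPureState_condvnEnt_le hN hρ₀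
  obtain ⟨ρ₁, hρ₁, -⟩ := condvnEnt_tensorId_reindex_le hN (Fintype.equivFin A).symm hρ₀
  have : Nonempty {ψ : Matrix (A × A) (A × A) ℂ // IsPureState ψ} := ⟨⟨ψ₀, hψ₀⟩⟩
  have : Nonempty (Σ k : ℕ, {ρ : Matrix (A × Fin k) (A × Fin k) ℂ // IsState ρ}) :=
    ⟨⟨_, ρ₁, hρ₁⟩⟩
  rw [chEnt, hrel]
  apply le_antisymm
  · refine le_ciInf fun ψ => ?_
    obtain ⟨ρ, hρ, h⟩ := condvnEnt_tensorId_reindex_le hN (Fintype.equivFin A).symm ψ.2.1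
    have := le_ciSup (f := fun p : Σ k : ℕ, {ρ : Matrix (A × Fin k) (A × Fin k) ℂ // IsState ρ} =>
      Real.logb 2 (Fintype.card B) - condvnEnt (tensorId N (Fin p.1) p.2.1))
      ⟨_, by rintro _ ⟨p, rfl⟩; exact hle p⟩ ⟨_, ρ, hρ⟩
    dsimp only at this
    linarith
  · have := ciSup_le hle
    linarith

end QIT
end
end

section
/- Let α ∈ [1/2, 1). Let ρ_AB and σ_AB be bipartite states with the same marginal ρ_B = σ_B and trace distance (1/2)‖ρ − σ‖₁ = ε ∈ [0,1]. Then |H̃↓_α(A|B)_ρ − H̃↓_α(A|B)_σ| ≤ log(1+ε) + (1/(1−α))·log(1 + ε^α·|A|^{2(1−α)}). -/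
open scoped Kronecker ComplexOrder

noncomputable section

namespace QIT

variable {n : Type*} [Fintype n] [DecidableEq n]

variable {a b c r : Type*} [Fintype a] [DecidableEq a] [Fintype b] [DecidableEq b]
  [Fintype c] [DecidableEq c] [Fintype r] [DecidableEq r]

section Continuity

set_option linter.unusedSectionVars false

open scoped MatrixOrder Matrix.Norms.L2Operator

lemma rtr_mono {A B : Matrix n n ℂ} (h : A ≤ B) : rtr A ≤ rtr B := by
  have := (Matrix.le_iff.mp h).trace_nonneg
  rw [Matrix.trace_sub, sub_nonneg] at this
  exact (Complex.le_def.mp this).1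

lemma mfun_eq_cfc (f : ℝ → ℝ) {A : Matrix n n ℂ} (hA : A.IsHermitian) :
    mfun f A = cfc f A := by
  rw [hA.cfc_eq, Matrix.IsHermitian.cfc, Unitary.conjStarAlgAut_apply, mfun, dif_pos hA]
  rfl

lemma continuousOn_spectrum (f : ℝ → ℝ) (A : Matrix n n ℂ) :
    ContinuousOn f (spectrum ℝ A) :=
  Matrix.finite_real_spectrum.continuousOn f

/-- The diagonal of `C` in the eigenbasis of `S`. -/
def eigenDiag {S : Matrix n n ℂ} (hS : S.IsHermitian) (C : Matrix n n ℂ) (i : n) : ℝ :=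
  ((star (hS.eigenvectorUnitary : Matrix n n ℂ) * C * (hS.eigenvectorUnitary : Matrix n n ℂ)) i i).re

lemma rtr_cfc_mul (f : ℝ → ℝ) {S : Matrix n n ℂ} (hS : S.IsHermitian) (C : Matrix n n ℂ) :
    rtr (cfc f S * C) = ∑ i, f (hS.eigenvalues i) * eigenDiag hS C i := by
  rw [← mfun_eq_cfc f hS, mfun, dif_pos hS, rtr, Matrix.mul_assoc, Matrix.mul_assoc,
    Matrix.trace_mul_comm, Matrix.mul_assoc, Matrix.trace, Complex.re_sum]
  simp only [Matrix.diag_apply, Matrix.diagonal_mul, Complex.re_ofReal_mul]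
  rfl

lemma rtr_cfc (f : ℝ → ℝ) {S : Matrix n n ℂ} (hS : S.IsHermitian) :
    rtr (cfc f S) = ∑ i, f (hS.eigenvalues i) := by
  have := rtr_cfc_mul f hS 1
  simpa [eigenDiag] using this

lemma sum_eigenDiag {S : Matrix n n ℂ} (hS : S.IsHermitian) (C : Matrix n n ℂ) :
    ∑ i, eigenDiag hS C i = rtr C := by
  have := rtr_cfc_mul (fun _ => 1) hS C
  rw [cfc_const_one ℝ S hS.isSelfAdjoint] at this
  simpa using this.symm

lemma eigenDiag_mono {S : Matrix n n ℂ} (hS : S.IsHermitian) {C D : Matrix n n ℂ} (h : C ≤ D)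
    (i : n) : eigenDiag hS C i ≤ eigenDiag hS D i := by
  have := (Matrix.le_iff.mp (star_left_conjugate_le_conjugate h
    (hS.eigenvectorUnitary : Matrix n n ℂ))).diag_nonneg (i := i)
  rw [Matrix.sub_apply, sub_nonneg] at this
  exact (Complex.le_def.mp this).1

lemma eigenDiag_zero {S : Matrix n n ℂ} (hS : S.IsHermitian) (i : n) :
    eigenDiag hS 0 i = 0 := by
  simp [eigenDiag]

lemma rtr_mul_mono {A B C : Matrix n n ℂ} (h : A ≤ B) (hC : 0 ≤ C) :
    rtr (C * A) ≤ rtr (C * B) := by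
  have hC' : C.IsHermitian := (Matrix.nonneg_iff_posSemidef.mp hC).isHermitian
  have hid : cfc (fun x : ℝ => x) C = C := cfc_id' ℝ C hC'.isSelfAdjoint
  rw [← hid, rtr_cfc_mul _ hC', rtr_cfc_mul _ hC']
  exact Finset.sum_le_sum fun i _ => mul_le_mul_of_nonneg_left (eigenDiag_mono hC' h i)
    ((Matrix.nonneg_iff_posSemidef.mp hC).eigenvalues_nonneg i)

/-- The eigenbasis diagonal of `f(S) C g(S)`. -/
lemma eigenDiag_conj (f : ℝ → ℝ) {S : Matrix n n ℂ} (hS : S.IsHermitian) (C : Matrix n n ℂ)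
    (i : n) : eigenDiag hS (cfc f S * C * cfc f S) i
      = f (hS.eigenvalues i) ^ 2 * eigenDiag hS C i := by
  set U : Matrix n n ℂ := (hS.eigenvectorUnitary : Matrix n n ℂ) with hU
  have h1 : star U * U = 1 := Unitary.coe_star_mul_self hS.eigenvectorUnitary
  set D : Matrix n n ℂ := Matrix.diagonal fun i => ((f (hS.eigenvalues i) : ℝ) : ℂ) with hD
  have hf : cfc f S = U * D * star U := by
    rw [← mfun_eq_cfc f hS, mfun, dif_pos hS]
  have : star U * (cfc f S * C * cfc f S) * U = D * (star U * C * U) * D := by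
    rw [hf]
    calc _ = (star U * U) * D * (star U * C * U) * D * (star U * U) := by
            simp only [Matrix.mul_assoc]
      _ = _ := by rw [h1]; simp
  rw [eigenDiag, this, hD, Matrix.mul_diagonal, Matrix.diagonal_mul, mul_right_comm,
    ← Complex.ofReal_mul, Complex.re_ofReal_mul, sq]
  rfl

lemma eigenDiag_cfc (f : ℝ → ℝ) {S X : Matrix n n ℂ} (hS : S.IsHermitian) (hX : X.IsHermitian)
    (i : n) : eigenDiag hS (cfc f X) i = ∑ j, Complex.normSq
      ((star (hS.eigenvectorUnitary : Matrix n n ℂ) * (hX.eigenvectorUnitary : Matrix n n ℂ)) i j)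
        * f (hX.eigenvalues j) := by
  have : star (hS.eigenvectorUnitary : Matrix n n ℂ) * cfc f X *
      (hS.eigenvectorUnitary : Matrix n n ℂ) =
      (star (hS.eigenvectorUnitary : Matrix n n ℂ) * (hX.eigenvectorUnitary : Matrix n n ℂ)) *
      Matrix.diagonal (fun i => ((f (hX.eigenvalues i) : ℝ) : ℂ)) *
      star (star (hS.eigenvectorUnitary : Matrix n n ℂ) *
        (hX.eigenvectorUnitary : Matrix n n ℂ)) := by
    rw [← mfun_eq_cfc f hX, mfun, dif_pos hX, star_mul, star_star]
    simp only [Matrix.mul_assoc]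
  rw [eigenDiag, this, Matrix.mul_apply, Complex.re_sum]
  refine Finset.sum_congr rfl fun j _ => ?_
  rw [Matrix.mul_diagonal, Matrix.star_apply, mul_right_comm, Complex.star_def, Complex.mul_conj,
    ← Complex.ofReal_mul, Complex.ofReal_re]

/-- The Peierls inequality for concave functions. -/
lemma rtr_cfc_le_sum_eigenDiag {f : ℝ → ℝ} (hf : ConcaveOn ℝ (Set.Ici 0) f)
    {S X : Matrix n n ℂ} (hS : S.IsHermitian) (hX : X.PosSemidef) :
    rtr (cfc f X) ≤ ∑ i, f (eigenDiag hS X i) := by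
  rw [← sum_eigenDiag hS]
  refine Finset.sum_le_sum fun i _ => ?_
  have hX' := hX.isHermitian
  have hid : cfc (fun x : ℝ => x) X = X := cfc_id' ℝ X hX'.isSelfAdjoint
  have hone : ∑ j, Complex.normSq ((star (hS.eigenvectorUnitary : Matrix n n ℂ) *
      (hX'.eigenvectorUnitary : Matrix n n ℂ)) i j) = 1 := by
    have := eigenDiag_cfc (fun _ => 1) hS hX' i
    rw [cfc_const_one ℝ X hX'.isSelfAdjoint] at this
    simpa [eigenDiag] using this.symm
  conv_rhs => rw [← hid]
  rw [eigenDiag_cfc _ hS hX', eigenDiag_cfc _ hS hX']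
  simpa only [smul_eq_mul] using hf.le_map_sum (t := Finset.univ)
    (p := fun j => hX'.eigenvalues j) (fun j _ => Complex.normSq_nonneg _) hone
    (fun j _ => hX.eigenvalues_nonneg j)

lemma nonneg_eigenDiag {S C : Matrix n n ℂ} (hS : S.IsHermitian) (hC : C.PosSemidef) (i : n) :
    0 ≤ eigenDiag hS C i := by
  simpa [eigenDiag_zero] using eigenDiag_mono hS (Matrix.nonneg_iff_posSemidef.mpr hC) i

lemma isHermitian_cfc (f : ℝ → ℝ) (A : Matrix n n ℂ) : (cfc f A).IsHermitian :=
  cfc_predicate f A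

lemma posSemidef_conj (f : ℝ → ℝ) {C : Matrix n n ℂ} (hC : C.PosSemidef) (S : Matrix n n ℂ) :
    (cfc f S * C * cfc f S).PosSemidef := by
  have := hC.mul_mul_conjTranspose_same (cfc f S)
  rwa [(isHermitian_cfc f S).eq] at this

lemma conj_mono (f : ℝ → ℝ) {C D : Matrix n n ℂ} (h : C ≤ D) (S : Matrix n n ℂ) :
    cfc f S * C * cfc f S ≤ cfc f S * D * cfc f S := by
  have := posSemidef_conj f (Matrix.le_iff.mp h) S
  rwa [Matrix.mul_sub, Matrix.sub_mul] at this

lemma sum_rpow_mul_rpow_le {ι : Type*} (t : Finset ι) {α : ℝ} (h0 : 0 < α) (h1 : α < 1)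
    {s p : ι → ℝ} (hs : ∀ i, 0 ≤ s i) (hp : ∀ i, 0 ≤ p i) :
    ∑ i ∈ t, s i ^ (1 - α) * p i ^ α ≤ (∑ i ∈ t, s i) ^ (1 - α) * (∑ i ∈ t, p i) ^ α := by
  have hpq : (1 - α)⁻¹.HolderConjugate α⁻¹ := by
    rw [Real.holderConjugate_iff]
    exact ⟨(one_lt_inv₀ (by linarith)).mpr (by linarith), by simp⟩
  have := Real.inner_le_Lp_mul_Lq_of_nonneg t hpq (f := fun i => s i ^ (1 - α))
    (g := fun i => p i ^ α) (fun i _ => Real.rpow_nonneg (hs i) _)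
    (fun i _ => Real.rpow_nonneg (hp i) _)
  simpa only [Real.rpow_rpow_inv (hs _) (sub_pos.mpr h1).ne', Real.rpow_rpow_inv (hp _) h0.ne',
    one_div, inv_inv] using this

/-- Upper bound on the sandwiched trace functional. -/
lemma rtr_sandwich_le {α : ℝ} (h0 : 0 < α) (h1 : α < 1) {P S : Matrix n n ℂ}
    (hP : P.PosSemidef) (hS : S.PosSemidef) :
    rtr (cfc (fun x : ℝ => x ^ α) (cfc (fun x : ℝ => x ^ ((1 - α) / (2 * α))) S * P *
      cfc (fun x : ℝ => x ^ ((1 - α) / (2 * α))) S)) ≤ rtr S ^ (1 - α) * rtr P ^ α := by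
  have hS' := hS.isHermitian
  have hconc := Real.concaveOn_rpow h0.le h1.le
  refine (rtr_cfc_le_sum_eigenDiag hconc hS' (posSemidef_conj _ hP S)).trans ?_
  have hid : cfc (fun x : ℝ => x) S = S := cfc_id' ℝ S hS'.isSelfAdjoint
  have hS1 : rtr S = ∑ i, hS'.eigenvalues i := by
    conv_lhs => rw [← hid]
    rw [rtr_cfc _ hS']
  rw [hS1, ← sum_eigenDiag hS' P]
  refine le_of_eq_of_le (Finset.sum_congr rfl fun i _ => ?_)
    (sum_rpow_mul_rpow_le Finset.univ h0 h1 hS.eigenvalues_nonneg (nonneg_eigenDiag hS' hP))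
  have hs := hS.eigenvalues_nonneg i
  rw [eigenDiag_conj, Real.mul_rpow (by positivity) (nonneg_eigenDiag hS' hP i),
    ← Real.rpow_natCast, ← Real.rpow_mul hs, ← Real.rpow_mul hs]
  congr 2
  field_simp
  norm_num

lemma isStrictlyPositive_cfc_add_const {A : Matrix n n ℂ} (hA : A.PosSemidef) {δ : ℝ} (hδ : 0 < δ) :
    IsStrictlyPositive (cfc (fun x : ℝ => x + δ) A) := by
  rw [cfc_add_const δ (fun x => x) A (continuousOn_spectrum _ _) hA.isHermitian.isSelfAdjoint,
    cfc_id' ℝ A hA.isHermitian.isSelfAdjoint]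
  exact IsStrictlyPositive.nonneg_add (Matrix.nonneg_iff_posSemidef.mpr hA)
    (isStrictlyPositive_algebraMap hδ)

/-- The map `x ↦ (x + δ) ^ (-p)` is operator antitone for `p ∈ (0, 1]`. -/
lemma cfc_shift_rpow_neg_anti {A B : Matrix n n ℂ} (hA : A.PosSemidef) (hAB : A ≤ B)
    {δ p : ℝ} (hδ : 0 < δ) (hp : p ∈ Set.Ioc (0 : ℝ) 1) :
    cfc (fun x : ℝ => (x + δ) ^ (-p)) B ≤ cfc (fun x : ℝ => (x + δ) ^ (-p)) A := by
  have hB : B.PosSemidef := Matrix.nonneg_iff_posSemidef.mp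
    ((Matrix.nonneg_iff_posSemidef.mpr hA).trans hAB)
  have key : ∀ {C : Matrix n n ℂ}, C.PosSemidef → cfc (fun x : ℝ => (x + δ) ^ (-p)) C
      = (cfc (fun x : ℝ => x + δ) C ^ p) ^ (-1 : ℝ) := by
    intro C hC
    rw [CFC.rpow_rpow _ _ _ hp.1.ne' (isStrictlyPositive_cfc_add_const hC hδ), mul_neg_one,
      CFC.cfc_rpow (fun x hx => ?_) (continuousOn_spectrum _ _) hC.isHermitian.isSelfAdjoint]
    have := spectrum_nonneg_of_nonneg (Matrix.nonneg_iff_posSemidef.mpr hC) hx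
    linarith
  rw [key hA, key hB]
  refine CStarAlgebra.rpow_neg_one_le_rpow_neg_one (CFC.rpow_le_rpow ⟨hp.1.le, hp.2⟩ ?_)
    ((isStrictlyPositive_cfc_add_const hA hδ).rpow _ _)
  rw [cfc_add_const δ (fun x => x) A (continuousOn_spectrum _ _) hA.isHermitian.isSelfAdjoint,
    cfc_id' ℝ A hA.isHermitian.isSelfAdjoint,
    cfc_add_const δ (fun x => x) B (continuousOn_spectrum _ _) hB.isHermitian.isSelfAdjoint,
    cfc_id' ℝ B hB.isHermitian.isSelfAdjoint]
  gcongr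

lemma rtr_rpow_mono {A B : Matrix n n ℂ} (hA : A.PosSemidef) (hAB : A ≤ B)
    {α : ℝ} (h0 : 0 ≤ α) (h1 : α ≤ 1) :
    rtr (cfc (fun x : ℝ => x ^ α) A) ≤ rtr (cfc (fun x : ℝ => x ^ α) B) := by
  have hA' := Matrix.nonneg_iff_posSemidef.mpr hA
  rw [← CFC.rpow_eq_cfc_real hA', ← CFC.rpow_eq_cfc_real (hA'.trans hAB)]
  exact rtr_mono (CFC.rpow_le_rpow ⟨h0, h1⟩ hAB)

lemma eigenDiag_cfc_self (f : ℝ → ℝ) {S : Matrix n n ℂ} (hS : S.IsHermitian) (i : n) :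
    eigenDiag hS (cfc f S) i = f (hS.eigenvalues i) := by
  rw [eigenDiag_cfc f hS hS, Unitary.coe_star_mul_self hS.eigenvectorUnitary,
    Finset.sum_eq_single i]
  · simp
  · intro j _ hj
    simp [Matrix.one_apply_ne hj.symm]
  · simp

lemma rtr_self_mul_cfc (f : ℝ → ℝ) {A : Matrix n n ℂ} (hA : A.IsHermitian) :
    rtr (A * cfc f A) = ∑ i, hA.eigenvalues i * f (hA.eigenvalues i) := by
  have hid : cfc (fun x : ℝ => x) A = A := cfc_id' ℝ A hA.isSelfAdjoint
  have := rtr_cfc_mul (fun x => x) hA (cfc f A)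
  simpa only [hid, eigenDiag_cfc_self] using this

lemma rtr_mul_shift_le {A : Matrix n n ℂ} (hA : A.PosSemidef) {δ α : ℝ} (hδ : 0 < δ)
    (h0 : 0 < α) (h1 : α < 1) :
    rtr (A * cfc (fun x : ℝ => (x + δ) ^ (-(1 - α))) A) ≤ rtr (cfc (fun x : ℝ => x ^ α) A) := by
  rw [rtr_self_mul_cfc _ hA.isHermitian, rtr_cfc _ hA.isHermitian]
  refine Finset.sum_le_sum fun i _ => ?_
  rcases (hA.eigenvalues_nonneg i).eq_or_lt' with h | h
  · simp [h, Real.zero_rpow h0.ne']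
  · set x := hA.isHermitian.eigenvalues i
    calc x * (x + δ) ^ (-(1 - α)) ≤ x * x ^ (-(1 - α)) := by
          gcongr x * ?_
          exact Real.rpow_le_rpow_of_nonpos h (by linarith) (by linarith)
      _ = x ^ α := by
          rw [← Real.rpow_one_add' h.le (by linarith)]
          ring_nf

lemma tendsto_shift_rpow {x p : ℝ} (hx : 0 < x) :
    Filter.Tendsto (fun δ : ℝ => (x + δ) ^ p) (nhdsWithin 0 (Set.Ioi 0)) (nhds (x ^ p)) := by
  have : ContinuousAt (fun δ : ℝ => (x + δ) ^ p) 0 :=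
    ContinuousAt.rpow_const (by fun_prop) (Or.inl (by simpa using hx.ne'))
  simpa [ContinuousAt] using this.tendsto.mono_left nhdsWithin_le_nhds

lemma tendsto_rtr_mul_shift {A : Matrix n n ℂ} (hA : A.PosSemidef) {α : ℝ}
    (h0 : 0 < α) :
    Filter.Tendsto (fun δ : ℝ => rtr (A * cfc (fun x : ℝ => (x + δ) ^ (-(1 - α))) A))
      (nhdsWithin 0 (Set.Ioi 0)) (nhds (rtr (cfc (fun x : ℝ => x ^ α) A))) := by
  simp only [rtr_self_mul_cfc _ hA.isHermitian, rtr_cfc _ hA.isHermitian]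
  refine tendsto_finsetSum _ fun i _ => ?_
  rcases (hA.eigenvalues_nonneg i).eq_or_lt' with h | h
  · simp [h, Real.zero_rpow h0.ne']
  · have := (tendsto_shift_rpow (p := -(1 - α)) h).const_mul (hA.isHermitian.eigenvalues i)
    rwa [← Real.rpow_one_add' h.le (by linarith), show 1 + -(1 - α) = α by ring] at this

lemma rtr_add (A B : Matrix n n ℂ) : rtr (A + B) = rtr A + rtr B := by
  simp [rtr]

/-- Subadditivity of `Tr X ^ α` for `α ∈ (0, 1)`. -/
lemma rtr_rpow_add_le {A B : Matrix n n ℂ} (hA : A.PosSemidef) (hB : B.PosSemidef) {α : ℝ}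
    (h0 : 0 < α) (h1 : α < 1) :
    rtr (cfc (fun x : ℝ => x ^ α) (A + B))
      ≤ rtr (cfc (fun x : ℝ => x ^ α) A) + rtr (cfc (fun x : ℝ => x ^ α) B) := by
  refine le_of_tendsto (tendsto_rtr_mul_shift (hA.add hB) h0) ?_
  filter_upwards [self_mem_nhdsWithin] with δ hδ
  have hA' := Matrix.nonneg_iff_posSemidef.mpr hA
  have hB' := Matrix.nonneg_iff_posSemidef.mpr hB
  have hp : 1 - α ∈ Set.Ioc (0 : ℝ) 1 := ⟨by linarith, by linarith⟩
  rw [Matrix.add_mul, rtr_add]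
  exact add_le_add
    ((rtr_mul_mono (cfc_shift_rpow_neg_anti hA (le_add_of_nonneg_right hB') hδ hp) hA').trans
      (rtr_mul_shift_le hA hδ h0 h1))
    ((rtr_mul_mono (cfc_shift_rpow_neg_anti hB (le_add_of_nonneg_left hA') hδ hp) hB').trans
      (rtr_mul_shift_le hB hδ h0 h1))

/-- Lower bound on the sandwiched trace functional. -/
lemma le_rtr_sandwich {α d : ℝ} (h0 : 0 < α) (h1 : α < 1) (hd : 0 < d) {P S : Matrix n n ℂ}
    (hP : P.PosSemidef) (hS : S.PosSemidef) (hPS : P ≤ d • S) :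
    d ^ (-(1 - α)) * rtr P ≤
    rtr (cfc (fun x : ℝ => x ^ α) (cfc (fun x : ℝ => x ^ ((1 - α) / (2 * α))) S * P *
      cfc (fun x : ℝ => x ^ ((1 - α) / (2 * α))) S)) := by
  have hS' := hS.isHermitian
  have hsa := hS'.isSelfAdjoint
  set m : ℝ → ℝ := fun x => x ^ ((1 - α) / (2 * α)) with hm
  set g : ℝ → ℝ := fun x => m x * (d * x) * m x with hg
  have hX := posSemidef_conj m hP S
  have hB : cfc m S * (d • S) * cfc m S = cfc g S := by
    rw [← cfc_const_mul_id d S hsa, ← cfc_mul _ _ _ (continuousOn_spectrum _ _)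
      (continuousOn_spectrum _ _), ← cfc_mul _ _ _ (continuousOn_spectrum _ _)
      (continuousOn_spectrum _ _)]
  have hXB : cfc m S * P * cfc m S ≤ cfc g S := hB ▸ conj_mono m hPS S
  have hp : 1 - α ∈ Set.Ioc (0 : ℝ) 1 := ⟨by linarith, by linarith⟩
  have hlim : Filter.Tendsto (fun δ : ℝ => ∑ i, (m (hS'.eigenvalues i) *
      (g (hS'.eigenvalues i) + δ) ^ (-(1 - α)) * m (hS'.eigenvalues i)) * eigenDiag hS' P i)
      (nhdsWithin 0 (Set.Ioi 0)) (nhds (∑ i, d ^ (-(1 - α)) * eigenDiag hS' P i)) := by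
    refine tendsto_finsetSum _ fun i _ => ?_
    rcases (hS.eigenvalues_nonneg i).eq_or_lt' with h | h
    · have : eigenDiag hS' P i = 0 := by
        refine le_antisymm ?_ (nonneg_eigenDiag hS' hP i)
        have := eigenDiag_mono hS' hPS i
        rwa [← cfc_const_mul_id d S hsa, eigenDiag_cfc_self, h, mul_zero] at this
      simp [this]
    · set s := hS'.eigenvalues i
      have hms : 0 < m s := Real.rpow_pos_of_pos h _
      have hgs : 0 < g s := by simp only [hg]; positivity
      have := (((tendsto_shift_rpow (p := -(1 - α)) hgs).const_mul (m s)).mul_const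
        (m s)).mul_const (eigenDiag hS' P i)
      convert this using 3
      have e : g s = d * s ^ (α⁻¹) := by
        simp only [hg, hm]
        rw [show s ^ ((1 - α) / (2 * α)) * (d * s) * s ^ ((1 - α) / (2 * α))
          = d * (s ^ ((1 - α) / (2 * α)) * s ^ (1 : ℝ) * s ^ ((1 - α) / (2 * α))) by
            rw [Real.rpow_one]; ring, ← Real.rpow_add h, ← Real.rpow_add h]
        congr 2
        field_simp
        ring
      rw [e, Real.mul_rpow hd.le (by positivity), ← Real.rpow_mul h.le]
      simp only [hm]
      rw [show s ^ ((1 - α) / (2 * α)) * (d ^ (-(1 - α)) * s ^ (α⁻¹ * -(1 - α))) *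
        s ^ ((1 - α) / (2 * α)) = d ^ (-(1 - α)) * (s ^ ((1 - α) / (2 * α)) *
          s ^ (α⁻¹ * -(1 - α)) * s ^ ((1 - α) / (2 * α))) by ring,
        ← Real.rpow_add h, ← Real.rpow_add h]
      rw [show (1 - α) / (2 * α) + α⁻¹ * -(1 - α) + (1 - α) / (2 * α) = 0 by field_simp; ring]
      simp
  rw [← Finset.mul_sum, sum_eigenDiag] at hlim
  refine le_of_tendsto hlim ?_
  filter_upwards [self_mem_nhdsWithin] with δ hδ
  refine le_trans (le_of_eq ?_) ((rtr_mul_mono (cfc_shift_rpow_neg_anti hX hXB hδ hp)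
    (Matrix.nonneg_iff_posSemidef.mpr hX)).trans (rtr_mul_shift_le hX hδ h0 h1))
  have hgim : ContinuousOn (fun x : ℝ => (x + δ) ^ (-(1 - α))) (g '' spectrum ℝ S) :=
    (Matrix.finite_real_spectrum.image g).continuousOn _
  rw [← cfc_comp' (fun x : ℝ => (x + δ) ^ (-(1 - α))) g S hgim (continuousOn_spectrum _ _) hsa,
    ← rtr_cfc_mul (fun x => m x * (g x + δ) ^ (-(1 - α)) * m x) hS',
    cfc_mul _ _ _ (continuousOn_spectrum _ _) (continuousOn_spectrum _ _),
    cfc_mul _ _ _ (continuousOn_spectrum _ _) (continuousOn_spectrum _ _), rtr, rtr,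
    Matrix.mul_assoc, Matrix.mul_assoc, Matrix.trace_mul_comm, Matrix.mul_assoc,
    Matrix.trace_mul_comm, Matrix.mul_assoc (cfc m S) P]

/-- The positive part of a traceless Hermitian matrix has half its trace norm as trace. -/
lemma exists_posSemidef_ge {D : Matrix n n ℂ} (hD : D.IsHermitian) (htr : rtr D = 0) :
    ∃ P : Matrix n n ℂ, P.PosSemidef ∧ D ≤ P ∧ rtr P = 2⁻¹ * traceNorm D := by
  have hsa := hD.isSelfAdjoint
  have hid : cfc (fun x : ℝ => x) D = D := cfc_id' ℝ D hsa
  refine ⟨cfc (fun x : ℝ => max x 0) D, Matrix.nonneg_iff_posSemidef.mp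
    (cfc_nonneg fun x _ => le_max_right _ _), ?_, ?_⟩
  · conv_lhs => rw [← hid]
    exact cfc_mono (fun x _ => le_max_left _ _) (continuousOn_spectrum _ _)
      (continuousOn_spectrum _ _)
  · have habs : mpow (D.conjTranspose * D) (2⁻¹ : ℝ) = cfc (fun x : ℝ => |x|) D := by
      rw [mpow, mfun_eq_cfc _ (Matrix.isHermitian_conjTranspose_mul_self D), hD.eq]
      conv_lhs => rw [← hid, ← cfc_mul _ _ _ (continuousOn_spectrum _ _)
        (continuousOn_spectrum _ _)]
      rw [← cfc_comp' (fun x : ℝ => x ^ (2⁻¹ : ℝ)) (fun x : ℝ => x * x) D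
        ((Matrix.finite_real_spectrum.image _).continuousOn _) (continuousOn_spectrum _ _) hsa]
      congr 1
      funext x
      rw [← one_div, ← Real.sqrt_eq_rpow, Real.sqrt_mul_self_eq_abs]
    have h0 : ∑ i, hD.eigenvalues i = 0 := by rw [← rtr_cfc (fun x => x) hD, hid, htr]
    have hmax : ∀ x : ℝ, max x 0 = 2⁻¹ * (|x| + x) := by
      intro x
      rcases le_total x 0 with h | h
      · rw [max_eq_right h, abs_of_nonpos h]; ring
      · rw [max_eq_left h, abs_of_nonneg h]; ring
    rw [traceNorm, habs, rtr_cfc _ hD, rtr_cfc _ hD]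
    simp only [hmax, ← Finset.mul_sum, Finset.sum_add_distrib, h0, add_zero]

/-- The operator `|k⟩⟨j| ⊗ 1`. -/
def blockUnit (k j : a) : Matrix (a × b) (a × b) ℂ := Matrix.single k j (1 : ℂ) ⊗ₖ 1

lemma blockUnit_conjTranspose (k j : a) :
    (blockUnit k j : Matrix (a × b) (a × b) ℂ).conjTranspose = blockUnit j k := by
  simp [blockUnit, Matrix.conjTranspose_kronecker]

lemma sum_blockUnit : ∑ k : a, (blockUnit k k : Matrix (a × b) (a × b) ℂ) = 1 := by
  ext p q
  simp [blockUnit, Matrix.sum_apply, Matrix.single_apply, Matrix.one_apply, Prod.ext_iff,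
    ite_and]
  split_ifs <;> rfl

lemma one_kronecker_ptraceA (ρ : Matrix (a × b) (a × b) ℂ) :
    (1 : Matrix a a ℂ) ⊗ₖ ptraceA ρ = ∑ k : a, ∑ j : a, blockUnit k j * ρ * blockUnit j k := by
  ext p q
  simp [blockUnit, Matrix.sum_apply, Matrix.single_apply, Matrix.one_apply, ptraceA,
    Matrix.mul_apply, Fintype.sum_prod_type, ite_and, eq_comm]

lemma rtr_one_kronecker_ptraceA (ρ : Matrix (a × b) (a × b) ℂ) :
    rtr ((1 : Matrix a a ℂ) ⊗ₖ ptraceA ρ) = Fintype.card a * rtr ρ := by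
  have : Matrix.trace (ptraceA ρ) = Matrix.trace ρ := by
    simp only [Matrix.trace, Matrix.diag_apply, ptraceA, Matrix.of_apply, Fintype.sum_prod_type]
    exact Finset.sum_comm
  simp [rtr, Matrix.trace_kronecker, this]

lemma blockUnit_conj_nonneg {ρ : Matrix (a × b) (a × b) ℂ} (hρ : ρ.PosSemidef) (k j : a) :
    0 ≤ blockUnit k j * ρ * blockUnit j k := by
  rw [← blockUnit_conjTranspose k j]
  exact Matrix.nonneg_iff_posSemidef.mpr (hρ.mul_mul_conjTranspose_same _)

lemma posSemidef_one_kronecker_ptraceA {ρ : Matrix (a × b) (a × b) ℂ} (hρ : ρ.PosSemidef) :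
    ((1 : Matrix a a ℂ) ⊗ₖ ptraceA ρ).PosSemidef := by
  rw [one_kronecker_ptraceA, ← Matrix.nonneg_iff_posSemidef]
  exact Finset.sum_nonneg fun k _ => Finset.sum_nonneg fun j _ => blockUnit_conj_nonneg hρ k j

/-- The operator inequality `ρ ≤ |A| (1 ⊗ ρ_B)`. -/
lemma le_card_smul_one_kronecker_ptraceA {ρ : Matrix (a × b) (a × b) ℂ} (hρ : ρ.PosSemidef) :
    ρ ≤ (Fintype.card a : ℝ) • ((1 : Matrix a a ℂ) ⊗ₖ ptraceA ρ) := by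
  set E : a → Matrix (a × b) (a × b) ℂ := fun k => blockUnit k k with hE
  have hEs : ∑ k, E k = 1 := sum_blockUnit
  have hdiag : ∑ k, E k * ρ * E k ≤ (1 : Matrix a a ℂ) ⊗ₖ ptraceA ρ := by
    rw [one_kronecker_ptraceA]
    exact Finset.sum_le_sum fun k _ => Finset.single_le_sum
      (f := fun j => blockUnit k j * ρ * blockUnit j k)
      (fun j _ => blockUnit_conj_nonneg hρ k j) (Finset.mem_univ k)
  have hpinch : 0 ≤ ∑ k, ∑ l, (E k - E l) * ρ * (E k - E l) :=
    Finset.sum_nonneg fun k _ => Finset.sum_nonneg fun l _ => by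
      have := hρ.mul_mul_conjTranspose_same (E k - E l)
      rw [Matrix.conjTranspose_sub, hE] at this
      simpa only [blockUnit_conjTranspose, ← Matrix.nonneg_iff_posSemidef] using this
  have hexp : ∑ k, ∑ l, (E k - E l) * ρ * (E k - E l)
      = (2 : ℝ) • ((Fintype.card a : ℝ) • (∑ k, E k * ρ * E k) - ρ) := by
    have h1 : ∑ k, ∑ l, E k * ρ * E l = ρ := by
      simp only [← Finset.mul_sum, hEs, ← Finset.sum_mul, mul_one, one_mul]
    have h2 : ∑ k, ∑ l, E l * ρ * E k = ρ := by rw [Finset.sum_comm, h1]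
    have h3 : ∀ k l, (E k - E l) * ρ * (E k - E l)
        = (E k * ρ * E k + E l * ρ * E l) - (E k * ρ * E l + E l * ρ * E k) := by
      intro k l
      noncomm_ring
    simp only [h3, Finset.sum_sub_distrib, Finset.sum_add_distrib, h1, h2, Finset.sum_const,
      Finset.card_univ, ← Nat.cast_smul_eq_nsmul ℝ, ← Finset.smul_sum]
    module
  rw [hexp] at hpinch
  have h2 : 0 ≤ (Fintype.card a : ℝ) • (∑ k, E k * ρ * E k) - ρ := by
    have := smul_nonneg (by norm_num : (0 : ℝ) ≤ 2⁻¹) hpinch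
    rwa [smul_smul, inv_mul_cancel₀ two_ne_zero, one_smul] at this
  exact (sub_nonneg.mp h2).trans (smul_le_smul_of_nonneg_left hdiag (by positivity))

lemma sandTr_eq (α : ℝ) {P S : Matrix n n ℂ} (hP : P.PosSemidef) (hS : S.PosSemidef) :
    sandTr α P S = rtr (cfc (fun x : ℝ => x ^ α) (cfc (fun x : ℝ => x ^ ((1 - α) / (2 * α))) S * P *
      cfc (fun x : ℝ => x ^ ((1 - α) / (2 * α))) S)) := by
  have := (posSemidef_conj (fun x : ℝ => x ^ ((1 - α) / (2 * α))) hP S).isHermitian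
  rw [sandTr, mpow, mpow, mfun_eq_cfc _ hS.isHermitian, mfun_eq_cfc _ this]

lemma sandTr_one_kronecker_ptraceA_ge {α : ℝ} (h0 : 0 < α) (h1 : α < 1)
    {ρ : Matrix (a × b) (a × b) ℂ} (hρ : IsState ρ) (hd : 0 < Fintype.card a) :
    (Fintype.card a : ℝ) ^ (-(1 - α)) ≤ sandTr α ρ ((1 : Matrix a a ℂ) ⊗ₖ ptraceA ρ) := by
  have hS := posSemidef_one_kronecker_ptraceA hρ.1
  rw [sandTr_eq α hρ.1 hS]
  simpa [rtr, hρ.2] using le_rtr_sandwich h0 h1 (Nat.cast_pos.mpr hd) hρ.1 hS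
    (le_card_smul_one_kronecker_ptraceA hρ.1)

lemma sandTr_le_of_dist {α : ℝ} (h0 : 0 < α) (h1 : α < 1)
    {ρ σ : Matrix (a × b) (a × b) ℂ} (hρ : IsState ρ) (hσ : IsState σ)
    (hmarg : ptraceA ρ = ptraceA σ) :
    sandTr α ρ ((1 : Matrix a a ℂ) ⊗ₖ ptraceA ρ) ≤ sandTr α σ ((1 : Matrix a a ℂ) ⊗ₖ ptraceA σ)
      + (Fintype.card a : ℝ) ^ (1 - α) * (2⁻¹ * traceNorm (ρ - σ)) ^ α := by
  have hS := posSemidef_one_kronecker_ptraceA hσ.1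
  obtain ⟨P, hP, hle, htr⟩ := exists_posSemidef_ge (hρ.1.isHermitian.sub hσ.1.isHermitian)
    (by simp [rtr, hρ.2, hσ.2])
  have hle' : ρ ≤ σ + P := by rwa [sub_le_iff_le_add'] at hle
  rw [hmarg, sandTr_eq α hρ.1 hS, sandTr_eq α hσ.1 hS, ← htr]
  set S := (1 : Matrix a a ℂ) ⊗ₖ ptraceA σ with hSdef
  have hm := conj_mono (fun x : ℝ => x ^ ((1 - α) / (2 * α))) hle' S
  rw [Matrix.mul_add, Matrix.add_mul] at hm
  refine (rtr_rpow_mono (posSemidef_conj _ hρ.1 S) hm h0.le h1.le).trans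
    ((rtr_rpow_add_le (posSemidef_conj _ hσ.1 S) (posSemidef_conj _ hP S) h0 h1).trans ?_)
  gcongr
  refine (rtr_sandwich_le h0 h1 hP hS).trans (le_of_eq ?_)
  rw [hSdef, rtr_one_kronecker_ptraceA]
  simp [rtr, hσ.2]

lemma condRenyiDown_sub_le {α : ℝ} (h0 : 0 < α) (h1 : α < 1)
    {ρ σ : Matrix (a × b) (a × b) ℂ} (hρ : IsState ρ) (hσ : IsState σ)
    (hmarg : ptraceA ρ = ptraceA σ) {ε : ℝ} (hε : 0 ≤ ε) (hdist : 2⁻¹ * traceNorm (ρ - σ) = ε) :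
    condRenyiDown α ρ - condRenyiDown α σ
      ≤ (1 - α)⁻¹ * Real.logb 2 (1 + ε ^ α * (Fintype.card a : ℝ) ^ (2 * (1 - α))) := by
  have hd : 0 < Fintype.card a := by
    rw [Fintype.card_pos_iff]
    by_contra h
    rw [not_nonempty_iff] at h
    simpa [Matrix.trace] using hρ.2
  have hd' : (0 : ℝ) < Fintype.card a := Nat.cast_pos.mpr hd
  have hQρ := sandTr_one_kronecker_ptraceA_ge h0 h1 hρ hd
  have hQσ := sandTr_one_kronecker_ptraceA_ge h0 h1 hσ hd
  have hle := sandTr_le_of_dist h0 h1 hρ hσ hmarg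
  have heq : ∀ τ : Matrix (a × b) (a × b) ℂ, condRenyiDown α τ
      = (1 - α)⁻¹ * Real.logb 2 (sandTr α τ ((1 : Matrix a a ℂ) ⊗ₖ ptraceA τ)) := by
    intro τ
    rw [condRenyiDown, sandRenyi, ← neg_mul, ← inv_neg, neg_sub]
  rw [heq, heq, ← mul_sub]
  rw [hdist] at hle
  set Qρ := sandTr α ρ ((1 : Matrix a a ℂ) ⊗ₖ ptraceA ρ)
  set Qσ := sandTr α σ ((1 : Matrix a a ℂ) ⊗ₖ ptraceA σ)
  set d : ℝ := (Fintype.card a : ℝ)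
  have hpos : 0 < d ^ (-(1 - α)) := Real.rpow_pos_of_pos hd' _
  have hQρ0 := hpos.trans_le hQρ
  have hQσ0 := hpos.trans_le hQσ
  refine mul_le_mul_of_nonneg_left ?_ (inv_nonneg.mpr (by linarith))
  rw [sub_le_iff_le_add, ← Real.logb_mul (by positivity) hQσ0.ne']
  refine Real.logb_le_logb_of_le (by norm_num) hQρ0 (hle.trans ?_)
  have hsplit : d ^ (1 - α) = d ^ (2 * (1 - α)) * d ^ (-(1 - α)) := by
    rw [← Real.rpow_add hd']
    ring_nf
  calc Qσ + d ^ (1 - α) * ε ^ α = Qσ + ε ^ α * d ^ (2 * (1 - α)) * d ^ (-(1 - α)) := by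
        rw [hsplit]; ring
    _ ≤ Qσ + ε ^ α * d ^ (2 * (1 - α)) * Qσ := by gcongr
    _ = _ := by ring

lemma traceNorm_sub_comm (A B : Matrix n n ℂ) : traceNorm (A - B) = traceNorm (B - A) := by
  rw [traceNorm, traceNorm, ← neg_sub B A, Matrix.conjTranspose_neg, neg_mul_neg]

end Continuity

theorem condRenyiDown_continuity {A B : Type} [Fintype A] [DecidableEq A] [Fintype B] [DecidableEq B]
    (α : ℝ) (hα : α ∈ Set.Ico (2⁻¹ : ℝ) 1)
    (ρ σ : Matrix (A × B) (A × B) ℂ) (hρ : IsState ρ) (hσ : IsState σ)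
    (hmarg : ptraceA ρ = ptraceA σ)
    (ε : ℝ) (hε : ε ∈ Set.Icc (0 : ℝ) 1) (hdist : 2⁻¹ * traceNorm (ρ - σ) = ε) :
    |condRenyiDown α ρ - condRenyiDown α σ|
      ≤ Real.logb 2 (1 + ε)
        + (1 - α)⁻¹ * Real.logb 2 (1 + ε ^ α * (Fintype.card A : ℝ) ^ (2 * (1 - α))) := by
  have h0 : 0 < α := lt_of_lt_of_le (by norm_num) hα.1
  have hlog : 0 ≤ Real.logb 2 (1 + ε) :=
    Real.logb_nonneg (by norm_num) (le_add_of_nonneg_right hε.1)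
  refine (abs_sub_le_iff.mpr ⟨?_, ?_⟩).trans (le_add_of_nonneg_left hlog)
  · exact condRenyiDown_sub_le h0 hα.2 hρ hσ hmarg hε.1 hdist
  · exact condRenyiDown_sub_le h0 hα.2 hσ hρ hmarg.symm hε.1 (traceNorm_sub_comm ρ σ ▸ hdist)

end QIT
end
end
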